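/- arXiv:2509.21954 — 8 statements merged into one kernel-verified Lean document; each statement's English description precedes it below -/
import Mathlib

section
/- Let a, b ∈ ℝ with b ≠ 0 and let ε > 0. Then ⟨a,b⟩ < ε if and only if every orbit of the translation T_a : ℝ/bℤ → ℝ/bℤ, T_a(x) = x + a (mod bℤ), is ε-dense in ℝ/bℤ; that is, ⟨a,b⟩ < ε if and only if for every x ∈ ℝ/bℤ and every open arc A ⊆ ℝ/bℤ of length ε there exists n ∈ ℕ with T_a^n(x) ∈ A. -/
open Set

/-- `⟨a,b⟩ := inf {|k·a + l·b| : k, l ∈ ℤ, k·a + l·b ≠ 0}`. -/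
noncomputable def pairInf (a b : ℝ) : ℝ :=
  sInf {r : ℝ | ∃ k l : ℤ, (k : ℝ) * a + (l : ℝ) * b ≠ 0 ∧ r = |(k : ℝ) * a + (l : ℝ) * b|}

/-- Stepping forward by `s > 0` with `s < ε` from `x`, one enters a translate by a multiple of `b`
of any given open interval of length `ε`. -/
theorem exists_nat_step_mem_Ioo_of_pos {b ε s : ℝ} (hb : b ≠ 0) (hs : 0 < s) (hsε : s < ε)
    (x c : ℝ) : ∃ (m : ℕ) (N : ℤ), x + m * s + N * b ∈ Ioo c (c + ε) := by
  obtain ⟨N, hN⟩ : ∃ N : ℤ, x - c ≤ N * b := by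
    refine ⟨⌈|x - c| / |b|⌉ * SignType.sign b, ?_⟩
    have h := (div_le_iff₀ (abs_pos.2 hb)).1 (Int.le_ceil (|x - c| / |b|))
    have hsign : ((SignType.sign b : ℤ) : ℝ) * b = |b| := by
      rcases hb.lt_or_gt with h | h
      · simp [sign_neg h, abs_of_neg h]
      · simp [sign_pos h, abs_of_pos h]
    rw [Int.cast_mul, mul_assoc, hsign]
    exact (le_abs_self _).trans h
  have hq : 0 ≤ (c + N * b - x) / s := div_nonneg (by linarith) hs.le
  have h1 := (div_lt_iff₀ hs).1 (Nat.lt_floor_add_one ((c + N * b - x) / s))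
  have h2 := (le_div_iff₀ hs).1 (Nat.floor_le hq)
  refine ⟨⌊(c + N * b - x) / s⌋₊ + 1, -N, ?_, ?_⟩ <;> push_cast <;> linarith

/-- Stepping by a nonzero `s` with `|s| < ε` from `x`, one enters a translate by a multiple of `b`
of any given open interval of length `ε`. -/
theorem exists_nat_step_mem_Ioo {b ε s : ℝ} (hb : b ≠ 0) (hs : s ≠ 0) (hsε : |s| < ε)
    (x c : ℝ) : ∃ (m : ℕ) (N : ℤ), x + m * s + N * b ∈ Ioo c (c + ε) := by
  rcases hs.lt_or_gt with h | h
  · obtain ⟨m, N, h1, h2⟩ := exists_nat_step_mem_Ioo_of_pos hb (neg_pos.2 h)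
      (by rwa [abs_of_neg h] at hsε) (-x) (-c - ε)
    refine ⟨m, -N, ?_, ?_⟩ <;> push_cast <;> linarith
  · exact exists_nat_step_mem_Ioo_of_pos hb h (by rwa [abs_of_pos h] at hsε) x c

/-- If `⟨a,b⟩ < ε`, then some `k * a + l * b` with `k` a natural number is nonzero and smaller
than `ε` in absolute value. -/
theorem exists_nat_int_abs_lt_of_pairInf_lt {a b ε : ℝ} (hb : b ≠ 0) (h : pairInf a b < ε) :
    ∃ (k : ℕ) (l : ℤ), k * a + l * b ≠ 0 ∧ |k * a + l * b| < ε := by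
  obtain ⟨_, ⟨k, l, hne, rfl⟩, hlt⟩ :=
    exists_lt_of_csInf_lt (by exact ⟨|b|, 0, 1, by simpa, by simp⟩) h
  obtain ⟨n, rfl | rfl⟩ := k.eq_nat_or_neg
  · exact ⟨n, l, by simpa using hne, by simpa using hlt⟩
  · have hneg : (n : ℝ) * a + ((-l : ℤ) : ℝ) * b
        = -(((-(n : ℤ) : ℤ) : ℝ) * a + (l : ℝ) * b) := by push_cast; ring
    exact ⟨n, -l, by rwa [hneg, neg_ne_zero], by rwa [hneg, abs_neg]⟩

theorem pairInf_le (a b : ℝ) {k l : ℤ} (h : (k : ℝ) * a + l * b ≠ 0) :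
    pairInf a b ≤ |(k : ℝ) * a + l * b| :=
  csInf_le ⟨0, by rintro _ ⟨k, l, -, rfl⟩; exact abs_nonneg _⟩ ⟨k, l, h, rfl⟩

/-- for `b ≠ 0` and `ε > 0`, `⟨a,b⟩ < ε` iff every orbit of the translation
`T_a : x ↦ x + a` on `ℝ/bℤ` is `ε`-dense: every open arc of length `ε` (image in `ℝ/bℤ` of
an open interval of length `ε` in `ℝ`) meets the orbit of every point. -/
theorem pairInf_lt_iff_orbits_eps_dense (a b ε : ℝ) (hb : b ≠ 0) (hε : 0 < ε) :
    pairInf a b < ε ↔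
      ∀ x : AddCircle b, ∀ c : ℝ,
        ∃ n : ℕ, x + n • ((a : AddCircle b)) ∈
          (fun r : ℝ => (r : AddCircle b)) '' Set.Ioo c (c + ε) := by
  constructor
  · intro h x c
    obtain ⟨k, l, hne, hlt⟩ := exists_nat_int_abs_lt_of_pairInf_lt hb h
    induction x using QuotientAddGroup.induction_on with | H x => ?_
    obtain ⟨m, N, hmem⟩ := exists_nat_step_mem_Ioo hb hne hlt x c
    refine ⟨m * k, _, hmem, ?_⟩
    change _ = (x : AddCircle b) + (m * k) • (a : AddCircle b)
    rw [← AddCircle.coe_nsmul, ← AddCircle.coe_add, ← sub_eq_zero, ← AddCircle.coe_sub,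
      AddCircle.coe_eq_zero_iff]
    refine ⟨m * l + N, ?_⟩
    simp only [zsmul_eq_mul, nsmul_eq_mul]
    push_cast
    ring
  · intro h
    obtain ⟨n, r, ⟨h0, hr⟩, hrn⟩ := h 0 0
    have hrn' : (r : AddCircle b) = ((n • a : ℝ) : AddCircle b) := by simpa using hrn
    obtain ⟨l, hl⟩ := (AddCircle.coe_eq_zero_iff b (x := r - n • a)).1 (by
      rw [AddCircle.coe_sub, hrn', sub_self])
    have hr' : ((n : ℤ) : ℝ) * a + l * b = r := by
      simp only [zsmul_eq_mul, nsmul_eq_mul] at hl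
      push_cast
      linarith
    have := pairInf_le a b (k := n) (l := l) (by rw [hr']; exact h0.ne')
    rw [hr', abs_of_pos h0] at this
    linarith
end

section
/- Let a, b ∈ ℝ with ab > 0, let ε > 0, and suppose ⟨a,b⟩ < ε. Then for every c ∈ ℝ there exist strictly increasing sequences (k_n)_{n∈ℕ} and (l_n)_{n∈ℕ} of positive integers such that c < k_n·a − l_n·b < c + ε for all n ∈ ℕ. -/
open Set

/-- Dirichlet approximation for `a / b > 0`, with both multipliers arbitrarily large. -/
theorem exists_large_nat_abs_mul_sub_mul_lt {a b η : ℝ} (hab : 0 < a * b) (hη : 0 < η) (N : ℕ) :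
    ∃ p q : ℕ, N < p ∧ N < q ∧ |(p : ℝ) * a - (q : ℝ) * b| < η := by
  have hb : b ≠ 0 := right_ne_zero_of_mul hab.ne'
  have hb' : 0 < |b| := abs_pos.mpr hb
  have ht : 0 < a / b := by
    have : a / b = a * b / b ^ 2 := by field_simp
    rw [this]
    positivity
  obtain ⟨M, hM⟩ := exists_nat_gt (max (N : ℝ) ((N + η / |b|) / (a / b)))
  obtain ⟨hMN, hMt⟩ := max_lt_iff.mp hM
  rw [div_lt_iff₀ ht] at hMt
  have hM0 : (0 : ℝ) < M := (Nat.cast_nonneg N).trans_lt hMN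
  obtain ⟨n, hn⟩ := exists_nat_gt (M * |b| / η)
  have hn0 : 0 < n := by
    have : (0 : ℝ) < n := lt_trans (by positivity) hn
    exact_mod_cast this
  obtain ⟨p, hp, -, happ⟩ := Real.exists_nat_abs_mul_sub_round_le (a / b) hn0
  have hp1 : (1 : ℝ) ≤ p := by exact_mod_cast hp
  set q : ℤ := round ((p : ℝ) * (a / b))
  have hclose : M * |(p : ℝ) * (a / b) - q| < η / |b| := by
    rw [div_lt_iff₀ hη] at hn
    rw [lt_div_iff₀ hb']
    calc M * |(p : ℝ) * (a / b) - q| * |b| ≤ M * (1 / (n + 1)) * |b| := by gcongr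
      _ = M * |b| / (n + 1) := by ring
      _ < η := by
        rw [div_lt_iff₀ (by positivity)]
        linarith
  have hq : (N : ℝ) < M * q := by
    have h1 : M * ((p : ℝ) * (a / b) - q) ≤ M * |(p : ℝ) * (a / b) - q| := by
      gcongr
      exact le_abs_self _
    have h2 : M * (a / b) ≤ p * (M * (a / b)) := le_mul_of_one_le_left (by positivity) hp1
    linarith
  have hq0 : 0 ≤ q := by
    have : (0 : ℝ) < q := pos_of_mul_pos_right ((Nat.cast_nonneg N).trans_lt hq) hM0.le
    exact_mod_cast this.le
  lift q to ℕ using hq0 with r hr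
  push_cast at hq hclose
  refine ⟨M * p, M * r, ?_, by exact_mod_cast hq, ?_⟩
  · have : (N : ℝ) < M * p := hMN.trans_le (le_mul_of_one_le_right hM0.le hp1)
    exact_mod_cast this
  · have : ((M * p : ℕ) : ℝ) * a - ((M * r : ℕ) : ℝ) * b = M * ((p : ℝ) * (a / b) - r) * b := by
      push_cast
      field_simp
    rw [this, abs_mul, abs_mul, Nat.abs_cast]
    exact (lt_div_iff₀ hb').mp hclose

/-- If `⟨a,b⟩ < ε`, every open interval of length `ε` contains an integer combination. -/
theorem exists_int_comb_mem_Ioo {a b ε : ℝ} (hab : a * b ≠ 0) (h : pairInf a b < ε) (c : ℝ) :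
    ∃ k l : ℤ, (k : ℝ) * a - (l : ℝ) * b ∈ Ioo c (c + ε) := by
  have hne : {r : ℝ | ∃ k l : ℤ, (k : ℝ) * a + (l : ℝ) * b ≠ 0 ∧
      r = |(k : ℝ) * a + (l : ℝ) * b|}.Nonempty :=
    ⟨_, 1, 0, by simpa using left_ne_zero_of_mul hab, rfl⟩
  obtain ⟨_, ⟨k, l, hkl, rfl⟩, hlt⟩ := exists_lt_of_csInf_lt hne h
  obtain ⟨k, l, hpos, hlt⟩ : ∃ k l : ℤ, 0 < (k : ℝ) * a + (l : ℝ) * b ∧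
      (k : ℝ) * a + (l : ℝ) * b < ε := by
    rcases hkl.lt_or_gt with hneg | hpos
    · rw [abs_of_neg hneg] at hlt
      exact ⟨-k, -l, by push_cast; linarith, by push_cast; linarith⟩
    · exact ⟨k, l, hpos, (le_abs_self _).trans_lt hlt⟩
  obtain ⟨m, ⟨hm, hm'⟩, -⟩ := existsUnique_add_zsmul_mem_Ioc hpos 0 c
  rw [zero_add, zsmul_eq_mul] at hm hm'
  refine ⟨m * k, -(m * l), ?_, ?_⟩ <;> push_cast <;> linarith

/-- if `ab > 0`, `ε > 0` and `⟨a,b⟩ < ε`, then for every `c ∈ ℝ` there are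
strictly increasing sequences of positive integers `(k_n)`, `(l_n)` with
`c < k_n·a − l_n·b < c + ε` for all `n`. -/
theorem exists_strictMono_seqs_of_pairInf_lt (a b ε : ℝ) (hab : 0 < a * b) (hε : 0 < ε)
    (h : pairInf a b < ε) :
    ∀ c : ℝ, ∃ k l : ℕ → ℕ, StrictMono k ∧ StrictMono l ∧
      (∀ n, 0 < k n) ∧ (∀ n, 0 < l n) ∧
      ∀ n : ℕ, c < (k n : ℝ) * a - (l n : ℝ) * b ∧ (k n : ℝ) * a - (l n : ℝ) * b < c + ε := by
  intro c
  obtain ⟨K, L, hKL⟩ := exists_int_comb_mem_Ioo hab.ne' h c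
  have hlarge : ∀ N : ℕ, ∃ k l : ℕ, N < k ∧ N < l ∧
      (k : ℝ) * a - (l : ℝ) * b ∈ Ioo c (c + ε) := by
    intro N
    obtain ⟨p, q, hp, hq, hpq⟩ := exists_large_nat_abs_mul_sub_mul_lt hab
      (lt_min (sub_pos.mpr hKL.1) (sub_pos.mpr hKL.2)) (N + K.natAbs + L.natAbs)
    obtain ⟨hη₁, hη₂⟩ := lt_min_iff.mp hpq
    obtain ⟨k, hk⟩ := Int.eq_ofNat_of_zero_le (a := K + p) (by omega)
    obtain ⟨l, hl⟩ := Int.eq_ofNat_of_zero_le (a := L + q) (by omega)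
    have hkR : (k : ℝ) = K + p := by exact_mod_cast hk.symm
    have hlR : (l : ℝ) = L + q := by exact_mod_cast hl.symm
    refine ⟨k, l, by omega, by omega, ?_, ?_⟩ <;> rw [hkR, hlR]
    · linarith [(abs_lt.mp hη₁).1]
    · linarith [(abs_lt.mp hη₂).2]
  choose k l hk hl hmem using hlarge
  obtain ⟨φ, hφ, hkφ⟩ := Filter.strictMono_subseq_of_tendsto_atTop
    (Filter.tendsto_atTop_mono (fun n => (hk n).le) Filter.tendsto_id)
  obtain ⟨ψ, hψ, hlψ⟩ := Filter.strictMono_subseq_of_tendsto_atTop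
    (Filter.tendsto_atTop_mono (fun n => (hφ.id_le n).trans (hl (φ n)).le) Filter.tendsto_id)
  exact ⟨fun n => k (φ (ψ n)), fun n => l (φ (ψ n)), hkφ.comp hψ, hlψ,
    fun n => (Nat.zero_le _).trans_lt (hk _), fun n => (Nat.zero_le _).trans_lt (hl _),
    fun n => hmem _⟩
end

section
/- Let α, β ∈ (0,1) and ε > 0 with ⟨ln α, ln β⟩ < ε. Then there exist positive integers K* and L* such that for every η ∈ (β², 1) there are integers K and L with 1 ≤ K ≤ K*, 1 ≤ L ≤ L*, and ln η < K·ln α − L·ln β < ln η + ε. -/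
open Set

/-- A bound on `pairInf a b` is witnessed by a positive integer combination of `a` and `b`. -/
theorem exists_pos_combination_lt_of_pairInf_lt {a b ε : ℝ} (ha : a ≠ 0)
    (h : pairInf a b < ε) :
    ∃ k l : ℤ, 0 < (k : ℝ) * a + (l : ℝ) * b ∧ (k : ℝ) * a + (l : ℝ) * b < ε := by
  have hne : {r : ℝ | ∃ k l : ℤ, (k : ℝ) * a + (l : ℝ) * b ≠ 0 ∧
      r = |(k : ℝ) * a + (l : ℝ) * b|}.Nonempty := ⟨_, 1, 0, by simpa using ha, rfl⟩
  obtain ⟨_, ⟨k, l, h0, rfl⟩, hlt⟩ := exists_lt_of_csInf_lt hne h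
  rcases lt_or_gt_of_ne h0 with hneg | hpos
  · rw [abs_of_neg hneg] at hlt
    refine ⟨-k, -l, ?_, ?_⟩ <;> push_cast <;> linarith
  · rw [abs_of_pos hpos] at hlt
    exact ⟨k, l, hpos, hlt⟩

/-- If some integer combination of `a, b < 0` lies in `(0, ε)`, then every point of a bounded
interval `(c, 0)` is approximated from above within `ε` by some `K * a - L * b` with `K, L`
positive and uniformly bounded. -/
theorem exists_bounded_mul_sub_mul_mem_Ioo {a b c ε : ℝ} (ha : a < 0) (hb : b < 0) {k l : ℤ}
    (hpos : 0 < (k : ℝ) * a + (l : ℝ) * b) (hlt : (k : ℝ) * a + (l : ℝ) * b < ε) :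
    ∃ M : ℕ, 0 < M ∧ ∀ t ∈ Set.Ioo c 0, ∃ K L : ℕ, 1 ≤ K ∧ K ≤ M ∧ 1 ≤ L ∧ L ≤ M ∧
      (K : ℝ) * a - (L : ℝ) * b ∈ Set.Ioo t (t + ε) := by
  set d := (k : ℝ) * a + (l : ℝ) * b with hd
  obtain ⟨N, hN⟩ := exists_nat_gt ((-c - a) / d)
  rw [div_lt_iff₀ hpos] at hN
  -- A large combination `q * a - p * b` in `[0, -a)` serves as a base point.
  obtain ⟨p, hp⟩ := exists_nat_gt (max ((N * |l| : ℤ) + 1 : ℝ) (((N * |k| : ℤ) + 2 : ℝ) * a / b))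
  obtain ⟨hpl, hpk⟩ := max_lt_iff.mp hp
  rw [div_lt_iff_of_neg hb] at hpk
  set q : ℤ := ⌊p * b / a⌋ with hq
  have hq1 : (q : ℝ) * a ≥ p * b := by
    have := Int.floor_le (p * b / a)
    rwa [le_div_iff_of_neg ha] at this
  have hq2 : ((q : ℝ) + 1) * a < p * b := by
    have := Int.lt_floor_add_one (p * b / a)
    rwa [div_lt_iff_of_neg ha] at this
  have hqk : N * |k| + 1 ≤ q := by
    have h1 : ((N * |k| : ℤ) + 2 : ℝ) < q + 1 := by
      by_contra! hle
      nlinarith [mul_le_mul_of_nonpos_right hle ha.le]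
    have h2 : N * |k| + 2 < q + 1 := by exact_mod_cast h1
    omega
  have hpl' : N * |l| + 1 ≤ (p : ℤ) := by
    have h2 : N * |l| + 1 < (p : ℤ) := by exact_mod_cast hpl
    omega
  refine ⟨p + q.toNat + N * k.natAbs + N * l.natAbs + 1, by omega, fun t ht => ?_⟩
  set s := t - (q * a - p * b) with hs
  set n : ℤ := ⌊s / d⌋ + 1 with hn
  have hn1 : s < n * d := by
    have := Int.lt_floor_add_one (s / d)
    rw [div_lt_iff₀ hpos] at this
    rw [hn]; push_cast; exact this
  have hn2 : (n : ℝ) * d ≤ s + d := by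
    have := Int.floor_le (s / d)
    rw [le_div_iff₀ hpos] at this
    rw [hn]; push_cast; linarith
  have hnN : |n| ≤ N := by
    rw [abs_le]
    constructor
    · have : (-(N : ℤ) : ℝ) < n := by
        have h1 : -((N : ℝ) * d) < n * d := by linarith [ht.1]
        push_cast
        by_contra! hle
        nlinarith [mul_le_mul_of_nonneg_right hle hpos.le]
      exact_mod_cast this.le
    · have h1 : (n : ℝ) < 1 := by
        by_contra! hle
        nlinarith [mul_le_mul_of_nonneg_right hle hpos.le, ht.2]
      have h2 : n < 1 := by exact_mod_cast h1
      omega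
  have hnk : |n * k| ≤ N * |k| := by
    rw [abs_mul]; exact mul_le_mul_of_nonneg_right hnN (abs_nonneg k)
  have hnl : |n * l| ≤ N * |l| := by
    rw [abs_mul]; exact mul_le_mul_of_nonneg_right hnN (abs_nonneg l)
  obtain ⟨hk1, hk2⟩ := abs_le.mp hnk
  obtain ⟨hl1, hl2⟩ := abs_le.mp hnl
  obtain ⟨K, hK⟩ := Int.eq_ofNat_of_zero_le (show 0 ≤ q + n * k by omega)
  obtain ⟨L, hL⟩ := Int.eq_ofNat_of_zero_le (show 0 ≤ p - n * l by omega)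
  have hcastK : ((N * k.natAbs : ℕ) : ℤ) = N * |k| := by simp
  have hcastL : ((N * l.natAbs : ℕ) : ℤ) = N * |l| := by simp
  have hval : (K : ℝ) * a - (L : ℝ) * b = (q * a - p * b) + n * d := by
    have h1 : (K : ℝ) = q + n * k := by exact_mod_cast hK.symm
    have h2 : (L : ℝ) = p - n * l := by exact_mod_cast hL.symm
    rw [h1, h2, hd]; ring
  refine ⟨K, L, by omega, by omega, by omega, by omega, ?_⟩
  rw [hval]
  constructor <;> linarith

/-- if `α, β ∈ (0,1)`, `ε > 0` and `⟨ln α, ln β⟩ < ε`, then there are positive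
integers `K*, L*` such that for every `η ∈ (β², 1)` there are `1 ≤ K ≤ K*`, `1 ≤ L ≤ L*`
with `ln η < K·ln α − L·ln β < ln η + ε`. -/
theorem exists_bounded_KL_of_pairInf_lt (α β ε : ℝ)
    (hα : α ∈ Set.Ioo (0:ℝ) 1) (hβ : β ∈ Set.Ioo (0:ℝ) 1) (hε : 0 < ε)
    (h : pairInf (Real.log α) (Real.log β) < ε) :
    ∃ Kstar Lstar : ℕ, 0 < Kstar ∧ 0 < Lstar ∧
      ∀ η ∈ Set.Ioo (β ^ 2) 1,
        ∃ K L : ℕ, 1 ≤ K ∧ K ≤ Kstar ∧ 1 ≤ L ∧ L ≤ Lstar ∧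
          Real.log η < (K : ℝ) * Real.log α - (L : ℝ) * Real.log β ∧
          (K : ℝ) * Real.log α - (L : ℝ) * Real.log β < Real.log η + ε := by
  have ha : Real.log α < 0 := Real.log_neg hα.1 hα.2
  have hb : Real.log β < 0 := Real.log_neg hβ.1 hβ.2
  obtain ⟨k, l, hpos, hlt⟩ := exists_pos_combination_lt_of_pairInf_lt ha.ne h
  obtain ⟨M, hM, hKL⟩ :=
    exists_bounded_mul_sub_mul_mem_Ioo (c := Real.log (β ^ 2)) ha hb hpos hlt
  refine ⟨M, M, hM, hM, fun η hη => ?_⟩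
  have hβ2 : 0 < β ^ 2 := pow_pos hβ.1 2
  obtain ⟨K, L, hK1, hKM, hL1, hLM, hmem⟩ := hKL (Real.log η)
    ⟨Real.log_lt_log hβ2 hη.1, Real.log_neg (hβ2.trans hη.1) hη.2⟩
  exact ⟨K, L, hK1, hKM, hL1, hLM, hmem.1, hmem.2⟩
end

section
/- Let f, g : [0,1] → [0,1] be C¹ diffeomorphisms with Hölder-continuous derivative such that f(0) = g(0) = 0, f(1) = g(1) = 1, f(t) < t and g(t) < t for all t ∈ (0,1), with α := f'(0) ∈ (0,1) and β := g'(0) ∈ (0,1), and let h : [0,1] → [0,1] be a C¹ diffeomorphism with h(0) = 0, h(1) = 1 and h' > 0. Then for every sufficiently small ε > 0 with ⟨ln α, ln β⟩ < ε there exist δ ∈ (0,1) and positive integers K*, L* such that: for every x ∈ (0, δ] and every closed interval J ⊆ I_x := (g(h(x)), h(x)] whose length satisfies |J|/|I_x| > 3ε/(1 − β − ε), there exist integers K and L with 1 ≤ K ≤ K*, 1 ≤ L ≤ L*, and g^{−L}(h(f^{K}(x))) ∈ J. -/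
open Set MeasureTheory

/-- `f` is a `C¹` diffeomorphism of `[0,1]` with derivative function `f'` which is strictly
positive and Hölder continuous on `[0,1]` (the class `C^{1+}`). -/
def IsC1PlusDiffeo (f f' : ℝ → ℝ) : Prop :=
  Set.BijOn f (Set.Icc 0 1) (Set.Icc 0 1) ∧
  (∀ x ∈ Set.Icc (0:ℝ) 1, HasDerivWithinAt f (f' x) (Set.Icc 0 1) x) ∧
  ContinuousOn f' (Set.Icc 0 1) ∧
  (∀ x ∈ Set.Icc (0:ℝ) 1, 0 < f' x) ∧
  ∃ C θ : ℝ, 0 < θ ∧ θ ≤ 1 ∧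
    ∀ x ∈ Set.Icc (0:ℝ) 1, ∀ y ∈ Set.Icc (0:ℝ) 1, |f' x - f' y| ≤ C * |x - y| ^ θ

/-- A `C^{1+}` diffeomorphism of `[0,1]` fixing `0` and `1`, with `f t < t` on `(0,1)`. -/
def IsC1PlusNS (f f' : ℝ → ℝ) : Prop :=
  IsC1PlusDiffeo f f' ∧ f 0 = 0 ∧ f 1 = 1 ∧ ∀ t ∈ Set.Ioo (0:ℝ) 1, f t < t

open Filter Topology

theorem exists_nat_combination_of_pairInf_lt {a b ε : ℝ} (ha : a < 0) (hb : b < 0)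
    (hεa : ε < -a) (hεb : ε < -b) (h : pairInf a b < ε) :
    ∃ k l : ℕ, (k : ℝ) * a - l * b ≠ 0 ∧ |(k : ℝ) * a - l * b| < ε := by
  obtain ⟨r, ⟨p, q, hne, rfl⟩, hlt⟩ := exists_lt_of_csInf_lt
    (s := {r : ℝ | ∃ k l : ℤ, (k : ℝ) * a + (l : ℝ) * b ≠ 0 ∧ r = |(k : ℝ) * a + (l : ℝ) * b|})
    ⟨_, 1, 0, by simpa using ha.ne, rfl⟩ h
  have same_sign : ∀ p q : ℤ, 0 ≤ p → 0 ≤ q → (p : ℝ) * a + q * b ≠ 0 →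
      ε ≤ -((p : ℝ) * a + q * b) := by
    intro p q hp hq hne
    have hp' : (0 : ℝ) ≤ p := by exact_mod_cast hp
    have hq' : (0 : ℝ) ≤ q := by exact_mod_cast hq
    rcases hp.eq_or_lt with rfl | hp
    · rcases hq.eq_or_lt with rfl | hq
      · simp at hne
      · have : (1 : ℝ) ≤ q := by exact_mod_cast hq
        push_cast
        nlinarith
    · have : (1 : ℝ) ≤ p := by exact_mod_cast hp
      nlinarith
  obtain ⟨h1, h2⟩ := abs_lt.1 hlt
  rcases le_total 0 p with hp | hp <;> rcases le_total 0 q with hq | hq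
  · linarith [same_sign p q hp hq hne]
  · refine ⟨p.natAbs, q.natAbs, ?_⟩
    have e1 : ((p.natAbs : ℕ) : ℝ) = p := by
      rw [Nat.cast_natAbs, abs_of_nonneg hp]
    have e2 : ((q.natAbs : ℕ) : ℝ) = -q := by
      rw [Nat.cast_natAbs, abs_of_nonpos hq]; push_cast; rfl
    rw [e1, e2, neg_mul, sub_neg_eq_add]
    exact ⟨hne, hlt⟩
  · refine ⟨p.natAbs, q.natAbs, ?_⟩
    have e1 : ((p.natAbs : ℕ) : ℝ) = -p := by
      rw [Nat.cast_natAbs, abs_of_nonpos hp]; push_cast; rfl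
    have e2 : ((q.natAbs : ℕ) : ℝ) = q := by
      rw [Nat.cast_natAbs, abs_of_nonneg hq]
    have e : -(p : ℝ) * a - q * b = -(p * a + q * b) := by ring
    rw [e1, e2, e, abs_neg]
    exact ⟨neg_ne_zero.2 hne, hlt⟩
  · have := same_sign (-p) (-q) (by omega) (by omega)
      (by push_cast; intro h0; exact hne (by linarith))
    push_cast at this
    linarith

theorem exists_bounded_approx_of_start {a b ε T : ℝ} {k l K₀ L₀ : ℕ}
    (hK₀ : 1 ≤ K₀) (hL₀ : 1 ≤ L₀) (hne : (k : ℝ) * a - l * b ≠ 0)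
    (hlt : |(k : ℝ) * a - l * b| < ε)
    (hdir : ∀ t ∈ Icc T 0, 0 ≤ (t - (K₀ * a - L₀ * b)) / (k * a - l * b)) :
    ∃ Kstar Lstar : ℕ, 0 < Kstar ∧ 0 < Lstar ∧ ∀ t ∈ Icc T 0, ∃ K L : ℕ,
      1 ≤ K ∧ K ≤ Kstar ∧ 1 ≤ L ∧ L ≤ Lstar ∧ |(K : ℝ) * a - L * b - t| < ε := by
  set σ : ℝ := k * a - l * b with hσ
  set t₀ : ℝ := K₀ * a - L₀ * b with ht₀
  have hσ0 : 0 < |σ| := abs_pos.2 hne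
  set N : ℕ := ⌊(|T| + |t₀|) / |σ|⌋₊
  refine ⟨K₀ + N * k, L₀ + N * l, by omega, by omega, fun t ht => ?_⟩
  have hy := hdir t ht
  set y := (t - t₀) / σ with hy_def
  have hyN : ⌊y⌋₊ ≤ N := by
    apply Nat.floor_le_floor
    rw [← abs_of_nonneg hy, hy_def, abs_div]
    gcongr
    refine (abs_sub t t₀).trans ?_
    have : |t| ≤ |T| := by
      rw [abs_of_nonpos ht.2, abs_of_nonpos (ht.1.trans ht.2)]
      linarith [ht.1]
    linarith
  refine ⟨K₀ + ⌊y⌋₊ * k, L₀ + ⌊y⌋₊ * l, by omega, by gcongr, by omega, by gcongr, ?_⟩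
  have ht : t = t₀ + y * σ := by rw [hy_def]; field_simp; ring
  have e : ((K₀ + ⌊y⌋₊ * k : ℕ) : ℝ) * a - ((L₀ + ⌊y⌋₊ * l : ℕ) : ℝ) * b - t
      = (⌊y⌋₊ - y) * σ := by
    rw [ht, hσ, ht₀]; push_cast; ring
  rw [e, abs_mul]
  have h1 := Nat.floor_le hy
  have h2 := Nat.lt_floor_add_one y
  have : |(⌊y⌋₊ : ℝ) - y| ≤ 1 := abs_le.2 ⟨by linarith, by linarith⟩
  nlinarith

theorem exists_bounded_approx {a b ε : ℝ} (ha : a < 0) (hb : b < 0)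
    (hεa : ε < -a) (hεb : ε < -b) (h : pairInf a b < ε) (T : ℝ) :
    ∃ Kstar Lstar : ℕ, 0 < Kstar ∧ 0 < Lstar ∧ ∀ t ∈ Icc T 0, ∃ K L : ℕ,
      1 ≤ K ∧ K ≤ Kstar ∧ 1 ≤ L ∧ L ≤ Lstar ∧ |(K : ℝ) * a - L * b - t| < ε := by
  obtain ⟨k, l, hne, hlt⟩ := exists_nat_combination_of_pairInf_lt ha hb hεa hεb h
  rcases lt_or_gt_of_ne hne with hs | hs
  · obtain ⟨n, hn⟩ := exists_nat_ge (a / b)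
    rw [div_le_iff_of_neg hb] at hn
    refine exists_bounded_approx_of_start (K₀ := 1) (L₀ := n + 1) le_rfl (by omega) hne hlt
      fun t ht => div_nonneg_of_nonpos ?_ hs.le
    push_cast
    linarith [ht.2]
  · obtain ⟨n, hn⟩ := exists_nat_ge ((T + b) / a)
    rw [div_le_iff_of_neg ha] at hn
    refine exists_bounded_approx_of_start (K₀ := n + 1) (L₀ := 1) (by omega) le_rfl hne hlt
      fun t ht => div_nonneg ?_ hs.le
    push_cast
    linarith [ht.1]

theorem tendsto_div_self_of_hasDerivWithinAt_zero {F : ℝ → ℝ} {d : ℝ}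
    (hF : HasDerivWithinAt F d (Icc 0 1) 0) (h0 : F 0 = 0) :
    Tendsto (fun x => F x / x) (𝓝[>] 0) (𝓝 d) := by
  have h := hasDerivWithinAt_iff_tendsto_slope.1 hF
  have hle : 𝓝[>] (0 : ℝ) ≤ 𝓝[Icc 0 1 \ {0}] 0 := by
    rw [← nhdsWithin_Ioo_eq_nhdsGT (zero_lt_one' ℝ)]
    exact nhdsWithin_mono _ fun x hx => ⟨Ioo_subset_Icc_self hx, hx.1.ne'⟩
  refine (h.mono_left hle).congr fun x => ?_
  simp [slope_def_field, h0]

theorem hasDerivWithinAt_inverse_zero {g ginv : ℝ → ℝ} {β : ℝ}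
    (hg : BijOn g (Icc 0 1) (Icc 0 1)) (hgc : ContinuousOn g (Icc 0 1)) (hg0 : g 0 = 0)
    (hg1 : g 1 = 1) (hd : HasDerivWithinAt g β (Icc 0 1) 0) (hβ : β ≠ 0)
    (hinv : InvOn ginv g (Icc 0 1) (Icc 0 1)) :
    HasDerivWithinAt ginv β⁻¹ (Icc 0 1) 0 := by
  have h0 : (0 : ℝ) ∈ Icc (0 : ℝ) 1 := by simp
  have hinv0 : ginv 0 = 0 := by simpa [hg0] using hinv.1 h0
  have hb : BijOn ginv (Icc 0 1) (Icc 0 1) := hg.symm hinv.symm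
  have hmono : StrictMonoOn g (Icc 0 1) :=
    hgc.strictMonoOn_of_injOn_Icc zero_le_one (by rw [hg0, hg1]; exact zero_le_one) hg.injOn
  have hcont : Tendsto ginv (𝓝[Icc 0 1] 0) (𝓝 0) := by
    rw [tendsto_order]
    refine ⟨fun c hc => ?_, fun c hc => ?_⟩
    · filter_upwards [self_mem_nhdsWithin] with y hy
      exact hc.trans_le (hb.mapsTo hy).1
    · have hm : min c 1 ∈ Icc (0 : ℝ) 1 := ⟨by positivity, min_le_right _ _⟩
      have hpos : 0 < g (min c 1) := by
        have := hmono h0 hm (by positivity)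
        rwa [hg0] at this
      filter_upwards [self_mem_nhdsWithin, mem_nhdsWithin_of_mem_nhds (Iio_mem_nhds hpos)]
        with y hy hlt
      by_contra! hcon
      have h1 := hmono.monotoneOn hm (hb.mapsTo hy) ((min_le_left _ _).trans hcon)
      rw [hinv.2 hy] at h1
      exact absurd hlt (not_lt.2 h1)
  rw [hasDerivWithinAt_iff_tendsto_slope] at hd ⊢
  have hmap : Tendsto ginv (𝓝[Icc 0 1 \ {0}] 0) (𝓝[Icc 0 1 \ {0}] 0) := by
    refine tendsto_nhdsWithin_iff.2 ⟨hcont.mono_left (nhdsWithin_mono _ sdiff_subset), ?_⟩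
    filter_upwards [self_mem_nhdsWithin] with y hy
    refine ⟨hb.mapsTo hy.1, fun h => hy.2 ?_⟩
    have := hinv.2 hy.1
    rw [mem_singleton_iff.1 h, hg0] at this
    exact this.symm
  refine ((hd.comp hmap).inv₀ hβ).congr' ?_
  filter_upwards [self_mem_nhdsWithin] with y hy
  simp [slope_def_field, hg0, hinv0, hinv.2 hy.1]

theorem tendsto_renormalized_ratio {f ginv h : ℝ → ℝ} {α γ η : ℝ}
    (hfm : MapsTo f (Icc 0 1) (Icc 0 1)) (hf : HasDerivWithinAt f α (Icc 0 1) 0) (hf0 : f 0 = 0)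
    (hgm : MapsTo ginv (Icc 0 1) (Icc 0 1)) (hg : HasDerivWithinAt ginv γ (Icc 0 1) 0)
    (hg0 : ginv 0 = 0)
    (hhm : MapsTo h (Icc 0 1) (Icc 0 1)) (hh : HasDerivWithinAt h η (Icc 0 1) 0) (hh0 : h 0 = 0)
    (hη : η ≠ 0) (K L : ℕ) :
    Tendsto (fun x => ginv^[L] (h (f^[K] x)) / h x) (𝓝[>] 0) (𝓝 (γ ^ L * α ^ K)) := by
  have hfK0 : f^[K] 0 = 0 := Function.iterate_fixed hf0 K
  have hgL0 : ginv^[L] 0 = 0 := Function.iterate_fixed hg0 L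
  have hfK := HasDerivWithinAt.iterate 0 hf hf0 hfm K
  have hgL := HasDerivWithinAt.iterate 0 hg hg0 hgm L
  have hhf : HasDerivWithinAt (fun x => h (f^[K] x)) (η * α ^ K) (Icc 0 1) 0 :=
    HasDerivWithinAt.comp (h₂ := h) 0 (by rwa [hfK0]) hfK (hfm.iterate K)
  have hall : HasDerivWithinAt (fun x => ginv^[L] (h (f^[K] x))) (γ ^ L * (η * α ^ K))
      (Icc 0 1) 0 :=
    HasDerivWithinAt.comp (h₂ := ginv^[L]) 0 (by rwa [hfK0, hh0]) hhf
      (hhm.comp (hfm.iterate K))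
  have h1 := tendsto_div_self_of_hasDerivWithinAt_zero hall (by rw [hfK0, hh0, hgL0])
  have h2 := tendsto_div_self_of_hasDerivWithinAt_zero hh hh0
  have e : γ ^ L * (η * α ^ K) / η = γ ^ L * α ^ K := by field_simp
  rw [← e]
  refine (h1.div h2 hη).congr' ?_
  filter_upwards [self_mem_nhdsWithin] with x hx
  exact div_div_div_cancel_right₀ (ne_of_gt hx) _ _

theorem abs_exp_sub_lt {s m ε : ℝ} (hε : ε ≤ 1) (hm : 0 < m)
    (hm1 : m ≤ 1 - 3 * ε / 2) (hs : |s - Real.log m| < ε) : |Real.exp s - m| < ε := by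
  obtain ⟨h1, h2⟩ := abs_lt.1 hs
  have hε0 : 0 < ε := (abs_nonneg _).trans_lt hs
  have e : Real.exp s = m * Real.exp (s - Real.log m) := by
    rw [Real.exp_sub, Real.exp_log hm]; field_simp
  have hub : Real.exp (s - Real.log m) ≤ 1 + ε + ε ^ 2 := by
    have h3 : Real.exp (s - Real.log m) ≤ Real.exp ε := Real.exp_le_exp.2 h2.le
    have h4 := Real.abs_exp_sub_one_sub_id_le (x := ε) (by rwa [abs_of_pos hε0])
    linarith [(abs_le.1 h4).2]
  have hlb : 1 - ε < Real.exp (s - Real.log m) := by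
    linarith [Real.add_one_le_exp (s - Real.log m)]
  rw [e, abs_lt]
  constructor
  · nlinarith
  · nlinarith [mul_le_mul_of_nonneg_left hub hm.le,
      mul_le_mul_of_nonneg_right hm1 (show 0 ≤ ε + ε ^ 2 by positivity), pow_pos hε0 2,
      pow_pos hε0 3]

/-- Claim: local intersection.  Here `ginv` is the inverse of `g` on `[0,1]`,
so `ginv^[L]` is `g^{−L}`, and `I_x = (g(h x), h x]` has length `h x − g (h x)`. -/
theorem local_intersection (f f' g g' ginv h h' : ℝ → ℝ)
    (hf : IsC1PlusNS f f') (hg : IsC1PlusNS g g')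
    (hα : f' 0 ∈ Set.Ioo (0:ℝ) 1) (hβ : g' 0 ∈ Set.Ioo (0:ℝ) 1)
    (hginv : Set.InvOn ginv g (Set.Icc 0 1) (Set.Icc 0 1))
    (hhbij : Set.BijOn h (Set.Icc 0 1) (Set.Icc 0 1))
    (hhderiv : ∀ x ∈ Set.Icc (0:ℝ) 1, HasDerivWithinAt h (h' x) (Set.Icc 0 1) x)
    (hhc : ContinuousOn h' (Set.Icc 0 1))
    (hhpos : ∀ x ∈ Set.Icc (0:ℝ) 1, 0 < h' x)
    (hh0 : h 0 = 0) (hh1 : h 1 = 1) :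
    ∃ ε₀ > (0:ℝ), ∀ ε : ℝ, 0 < ε → ε < ε₀ →
      pairInf (Real.log (f' 0)) (Real.log (g' 0)) < ε →
      ∃ δ ∈ Set.Ioo (0:ℝ) 1, ∃ Kstar Lstar : ℕ, 0 < Kstar ∧ 0 < Lstar ∧
        ∀ x ∈ Set.Ioc (0:ℝ) δ, ∀ u v : ℝ, u ≤ v →
          Set.Icc u v ⊆ Set.Ioc (g (h x)) (h x) →
          (v - u) / (h x - g (h x)) > 3 * ε / (1 - g' 0 - ε) →
          ∃ K L : ℕ, 1 ≤ K ∧ K ≤ Kstar ∧ 1 ≤ L ∧ L ≤ Lstar ∧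
            ginv^[L] (h (f^[K] x)) ∈ Set.Icc u v := by
  obtain ⟨⟨hfb, hfd, -⟩, hf0, -, -⟩ := hf
  obtain ⟨⟨hgb, hgd, -⟩, hg0, hg1, -⟩ := hg
  have z : (0 : ℝ) ∈ Icc (0 : ℝ) 1 := by simp
  set α := f' 0
  set β := g' 0
  have hgc : ContinuousOn g (Icc 0 1) := fun x hx => (hgd x hx).continuousWithinAt
  have hginvd := hasDerivWithinAt_inverse_zero hgb hgc hg0 hg1 (hgd 0 z) hβ.1.ne' hginv
  have hginvb : BijOn ginv (Icc 0 1) (Icc 0 1) := hgb.symm hginv.symm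
  have hginv0 : ginv 0 = 0 := by simpa [hg0] using hginv.1 z
  have hloga : Real.log α < 0 := Real.log_neg hα.1 hα.2
  have hlogb : Real.log β < 0 := Real.log_neg hβ.1 hβ.2
  refine ⟨min (1 - β) (min (-Real.log α) (-Real.log β)), by
    simpa using ⟨hβ.2, hloga, hlogb⟩, fun ε hε hlt hpair => ?_⟩
  simp only [lt_min_iff] at hlt
  obtain ⟨hεβ, hεa, hεb⟩ := hlt
  have hε1 : ε ≤ 1 := by linarith [hβ.1]
  obtain ⟨Kstar, Lstar, hK, hL, happrox⟩ :=
    exists_bounded_approx hloga hlogb hεa hεb hpair (Real.log (3 * ε / 2))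
  have hratio : ∀ᶠ x in 𝓝[>] (0 : ℝ), ∀ K ∈ Finset.range (Kstar + 1),
      ∀ L ∈ Finset.range (Lstar + 1),
        |ginv^[L] (h (f^[K] x)) / h x - β⁻¹ ^ L * α ^ K| < ε / 2 := by
    simp only [Filter.eventually_all_finset]
    intro K _ L _
    have := tendsto_renormalized_ratio hfb.mapsTo (hfd 0 z) hf0 hginvb.mapsTo hginvd hginv0
      hhbij.mapsTo (hhderiv 0 z) hh0 (hhpos 0 z).ne' K L
    exact (Metric.tendsto_nhds.1 this) (ε / 2) (by positivity)
  have hgratio : ∀ᶠ x in 𝓝[>] (0 : ℝ), g (h x) / h x < β + ε := by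
    have := tendsto_renormalized_ratio (K := 0) (L := 1) hfb.mapsTo (hfd 0 z) hf0 hgb.mapsTo
      (hgd 0 z) hg0 hhbij.mapsTo (hhderiv 0 z) hh0 (hhpos 0 z).ne'
    simp only [Function.iterate_one, Function.iterate_zero, id, pow_one, pow_zero, mul_one] at this
    exact this.eventually (Iio_mem_nhds (by linarith))
  obtain ⟨δ, hδ, hsub⟩ := mem_nhdsGT_iff_exists_Ioc_subset.1 (hratio.and hgratio)
  refine ⟨min δ (1 / 2), ⟨lt_min hδ (by norm_num), (min_le_right _ _).trans_lt (by norm_num)⟩,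
    Kstar, Lstar, hK, hL, fun x hx u v huv hJ hlen => ?_⟩
  obtain ⟨hxr, hxg⟩ := hsub ⟨hx.1, hx.2.trans (min_le_left _ _)⟩
  have hx1 : x ∈ Icc (0 : ℝ) 1 :=
    ⟨hx.1.le, hx.2.trans ((min_le_right _ _).trans (by norm_num))⟩
  have hhx := hhbij.mapsTo hx1
  have hhx0 : 0 < h x := by
    refine lt_of_le_of_ne hhx.1 fun h0 => hx.1.ne ?_
    exact hhbij.injOn z hx1 (by rw [hh0, h0])
  have hu := (hJ (left_mem_Icc.2 huv)).1
  have hv := (hJ (right_mem_Icc.2 huv)).2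
  have hgx := (hgb.mapsTo hhx).1
  rw [div_lt_iff₀ hhx0] at hxg
  have hI : (1 - β - ε) * h x < h x - g (h x) := by linarith
  have hIpos : 0 < h x - g (h x) := lt_trans (mul_pos (by linarith) hhx0) hI
  have hlong : 3 * ε * h x < v - u := by
    rw [gt_iff_lt, lt_div_iff₀ hIpos] at hlen
    refine lt_trans ?_ hlen
    have hc : 0 < 1 - β - ε := by linarith
    calc 3 * ε * h x = 3 * ε / (1 - β - ε) * ((1 - β - ε) * h x) := by field_simp
      _ < _ := by gcongr
  set m := (u + v) / 2 / h x with hm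
  have hmh : m * h x = (u + v) / 2 := by rw [hm]; field_simp
  have hm_lower : 3 * ε / 2 ≤ m := by
    rw [hm, le_div_iff₀ hhx0]; linarith
  have hm_upper : m ≤ 1 - 3 * ε / 2 := by
    rw [hm, div_le_iff₀ hhx0]; linarith
  have hm_pos : 0 < m := by linarith
  obtain ⟨K, L, hK1, hK2, hL1, hL2, hKL⟩ := happrox (Real.log m)
    ⟨Real.log_le_log (by positivity) hm_lower, Real.log_nonpos hm_pos.le (by linarith)⟩
  refine ⟨K, L, hK1, hK2, hL1, hL2, ?_⟩
  have hc := abs_exp_sub_lt hε1 hm_pos hm_upper hKL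
  have hexp : Real.exp (K * Real.log α - L * Real.log β) = β⁻¹ ^ L * α ^ K := by
    rw [Real.exp_sub, Real.exp_nat_mul, Real.exp_nat_mul, Real.exp_log hα.1, Real.exp_log hβ.1,
      inv_pow, div_eq_inv_mul]
  rw [hexp] at hc
  have hr := hxr K (Finset.mem_range.2 (by omega)) L (Finset.mem_range.2 (by omega))
  set w := ginv^[L] (h (f^[K] x))
  obtain ⟨hc1, hc2⟩ := abs_lt.1 hc
  obtain ⟨hr1, hr2⟩ := abs_lt.1 hr
  have hw : w / h x * h x = w := by field_simp
  have hw1 := mul_lt_mul_of_pos_right (show m - 3 * ε / 2 < w / h x by linarith) hhx0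
  have hw2 := mul_lt_mul_of_pos_right (show w / h x < m + 3 * ε / 2 by linarith) hhx0
  rw [hw] at hw1 hw2
  constructor <;> linarith
end

section
/- Let g : [0,1] → [0,1] be a C¹ diffeomorphism with Hölder-continuous derivative such that g(0) = 0, g(1) = 1, g(t) < t for all t ∈ (0,1), and β := g'(0) ∈ (0,1). Then there exist δ₀ ∈ (0,1) and ρ ∈ (0,1) such that for every y ∈ (0,1) and every closed interval J ⊆ (0,1) the following holds: defining the fundamental domains Ω_i := (g^{i+1}(y), g^{i}(y)] for i ∈ ℤ (where g^{i} for negative i denotes iterates of g^{−1}), J* := ⋃_{i∈ℤ} g^{i}(J), and J_i := J* ∩ Ω_i, one has ρ·(|J_i|/|Ω_i|) ≤ |J_j|/|Ω_j| ≤ ρ^{−1}·(|J_i|/|Ω_i|) whenever Ω_i ⊆ [0, δ₀] and Ω_j ⊆ [0, δ₀]. -/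
open Set MeasureTheory

/-- The `i`-th iterate of `g` for `i ∈ ℤ`, where negative `i` uses the inverse `ginv`. -/
def zIter (g ginv : ℝ → ℝ) : ℤ → ℝ → ℝ
  | Int.ofNat n => g^[n]
  | Int.negSucc n => ginv^[n + 1]

/-- Two-sided bounds on a positive derivative give two-sided bounds on the measure of an image. -/
theorem volume_image_toReal_bounds {f D : ℝ → ℝ} {T : Set ℝ} {m M : ℝ}
    (hT : MeasurableSet T) (hfin : volume T ≠ ⊤)
    (hf : ∀ x ∈ T, HasDerivWithinAt f (D x) T x) (hinj : InjOn f T) (hm : 0 ≤ m)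
    (hmD : ∀ x ∈ T, m ≤ D x) (hDM : ∀ x ∈ T, D x ≤ M) (hM : 0 ≤ M) :
    m * (volume T).toReal ≤ (volume (f '' T)).toReal ∧
      (volume (f '' T)).toReal ≤ M * (volume T).toReal := by
  have key : volume (f '' T) = ∫⁻ x in T, ENNReal.ofReal |D x| := by
    have h := lintegral_image_eq_lintegral_abs_deriv_mul hT hf hinj (fun _ => 1)
    simpa using h
  have h1 : ENNReal.ofReal m * volume T ≤ volume (f '' T) := by
    rw [key, ← setLIntegral_const]
    exact setLIntegral_mono' hT fun x hx =>
      ENNReal.ofReal_le_ofReal ((hmD x hx).trans (le_abs_self _))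
  have h2 : volume (f '' T) ≤ ENNReal.ofReal M * volume T := by
    rw [key, ← setLIntegral_const]
    refine setLIntegral_mono' hT fun x hx => ENNReal.ofReal_le_ofReal ?_
    rw [abs_of_nonneg (hm.trans (hmD x hx))]
    exact hDM x hx
  have hfin2 : ENNReal.ofReal M * volume T ≠ ⊤ := ENNReal.mul_ne_top ENNReal.ofReal_ne_top hfin
  constructor
  · have := ENNReal.toReal_mono (ne_top_of_le_ne_top hfin2 h2) h1
    rwa [ENNReal.toReal_mul, ENNReal.toReal_ofReal hm] at this
  · have := ENNReal.toReal_mono hfin2 h2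
    rwa [ENNReal.toReal_mul, ENNReal.toReal_ofReal hM] at this

/-- A map with distortion at most `K` on `S` changes relative measures in `S` by a factor at most
`K ^ 2`. -/
theorem relative_volume_image_bounds {f D : ℝ → ℝ} {S T : Set ℝ} {K : ℝ} (hK : 0 < K)
    (hS : MeasurableSet S) (hT : MeasurableSet T) (hTS : T ⊆ S) (hfin : volume S ≠ ⊤)
    (hne : S.Nonempty) (hpos : 0 < (volume S).toReal)
    (hf : ∀ x ∈ S, HasDerivWithinAt f (D x) S x) (hinj : InjOn f S)
    (hD : ∀ x ∈ S, 0 < D x) (hKD : ∀ a ∈ S, ∀ b ∈ S, D a ≤ K * D b) :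
    (volume (f '' T)).toReal / (volume (f '' S)).toReal ≤
        K ^ 2 * ((volume T).toReal / (volume S).toReal) ∧
      (volume T).toReal / (volume S).toReal ≤
        K ^ 2 * ((volume (f '' T)).toReal / (volume (f '' S)).toReal) := by
  obtain ⟨b, hb⟩ := hne
  have hd := hD b hb
  have hlow : ∀ x ∈ S, D b / K ≤ D x := fun x hx => by
    rw [div_le_iff₀ hK, mul_comm]
    exact hKD b hb x hx
  obtain ⟨hS1, hS2⟩ := volume_image_toReal_bounds hS hfin hf hinj (div_pos hd hK).le hlow
    (fun x hx => hKD x hx b hb) (by positivity)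
  obtain ⟨hT1, hT2⟩ := volume_image_toReal_bounds hT (measure_ne_top_of_subset hTS hfin)
    (fun x hx => (hf x (hTS hx)).mono hTS) (hinj.mono hTS) (div_pos hd hK).le
    (fun x hx => hlow x (hTS hx)) (fun x hx => hKD x (hTS hx) b hb) (by positivity)
  have ht : 0 ≤ (volume T).toReal := ENNReal.toReal_nonneg
  generalize (volume T).toReal = t at *
  generalize (volume S).toReal = s at *
  generalize (volume (f '' T)).toReal = t' at *
  generalize (volume (f '' S)).toReal = s' at *
  have hdK := div_pos hd hK
  have hs' : 0 < s' := lt_of_lt_of_le (by positivity) hS1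
  constructor
  · calc t' / s' ≤ (K * D b * t) / (D b / K * s) := by gcongr
      _ = K ^ 2 * (t / s) := by field_simp
  · calc t / s = K ^ 2 * ((D b / K * t) / (K * D b * s)) := by field_simp
      _ ≤ K ^ 2 * (t' / s') := by gcongr; exact (by positivity : (0:ℝ) ≤ D b / K * t).trans hT1

theorem leftInvOn_iterate {α : Type*} {f f' : α → α} {s : Set α} (h : LeftInvOn f' f s)
    (hmap : MapsTo f s s) (n : ℕ) : LeftInvOn f'^[n] f^[n] s := by
  induction n with
  | zero => exact fun x _ => rfl
  | succ n ih =>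
    intro x hx
    rw [Function.iterate_succ_apply' f, Function.iterate_succ_apply f', h (hmap.iterate n hx), ih hx]

theorem strictMonoOn_iterate {α : Type*} [Preorder α] {f : α → α} {s : Set α}
    (h : StrictMonoOn f s) (hmap : MapsTo f s s) (n : ℕ) : StrictMonoOn f^[n] s := by
  induction n with
  | zero => exact fun x _ y _ hxy => hxy
  | succ n ih =>
    rw [Function.iterate_succ']
    exact h.comp ih (hmap.iterate n)

section Iterates

variable {g g' ginv : ℝ → ℝ}

theorem IsC1PlusNS.strictMonoOn (hg : IsC1PlusNS g g') : StrictMonoOn g (Icc 0 1) := by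
  obtain ⟨⟨-, hd, -, hpos, -⟩, -⟩ := hg
  refine strictMonoOn_of_hasDerivWithinAt_pos (f' := g') (convex_Icc 0 1)
    (fun x hx => (hd x hx).continuousWithinAt) (fun x hx => ?_) (fun x hx => ?_)
  · exact (hd x (interior_subset hx)).mono interior_subset
  · exact hpos x (interior_subset hx)

theorem IsC1PlusNS.mapsTo_Ioo (hg : IsC1PlusNS g g') : MapsTo g (Ioo 0 1) (Ioo 0 1) := by
  intro x hx
  have hm := hg.strictMonoOn
  have h0 := hm (by simp : (0:ℝ) ∈ Icc (0:ℝ) 1) (Ioo_subset_Icc_self hx) hx.1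
  rw [hg.2.1] at h0
  exact ⟨h0, (hg.2.2.2 x hx).trans hx.2⟩

theorem mapsTo_inverse_Icc (hbij : BijOn g (Icc 0 1) (Icc 0 1))
    (hginv : InvOn ginv g (Icc 0 1) (Icc 0 1)) : MapsTo ginv (Icc 0 1) (Icc 0 1) :=
  hginv.1.mapsTo hbij.surjOn

theorem IsC1PlusNS.mapsTo_inverse_Ioo (hg : IsC1PlusNS g g')
    (hginv : InvOn ginv g (Icc 0 1) (Icc 0 1)) : MapsTo ginv (Ioo 0 1) (Ioo 0 1) := by
  intro x hx
  have hxI := Ioo_subset_Icc_self hx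
  have h := mapsTo_inverse_Icc hg.1.1 hginv hxI
  have he : g (ginv x) = x := hginv.2 hxI
  refine ⟨lt_of_le_of_ne h.1 fun h0 => ?_, lt_of_le_of_ne h.2 fun h1 => ?_⟩
  · rw [← h0, hg.2.1] at he
    exact hx.1.ne he
  · rw [h1, hg.2.2.1] at he
    exact hx.2.ne' he

theorem mapsTo_zIter {s : Set ℝ} (h : MapsTo g s s) (h' : MapsTo ginv s s) (i : ℤ) :
    MapsTo (zIter g ginv i) s s := by
  cases i with
  | ofNat n => exact h.iterate n
  | negSucc n => exact h'.iterate (n + 1)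

theorem apply_zIter {s : Set ℝ} (h' : MapsTo ginv s s) (hr : LeftInvOn g ginv s) (i : ℤ)
    {x : ℝ} (hx : x ∈ s) : g (zIter g ginv i x) = zIter g ginv (i + 1) x := by
  cases i with
  | ofNat n => exact (Function.iterate_succ_apply' g n x).symm
  | negSucc n =>
    have e : zIter g ginv (Int.negSucc n) x = ginv (ginv^[n] x) :=
      Function.iterate_succ_apply' ginv n x
    rw [e, hr (h'.iterate n hx)]
    cases n with
    | zero => rfl
    | succ k => rfl

theorem iterate_zIter {s : Set ℝ} (h' : MapsTo ginv s s) (hr : LeftInvOn g ginv s) (i : ℤ)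
    (n : ℕ) {x : ℝ} (hx : x ∈ s) : g^[n] (zIter g ginv i x) = zIter g ginv (i + n) x := by
  induction n with
  | zero => simp
  | succ n ih =>
    rw [Function.iterate_succ_apply', ih, apply_zIter h' hr _ hx]
    congr 1
    push_cast
    ring

theorem measurableSet_zIter_image {u v a b : ℝ} (hc : ContinuousOn g (Icc a b))
    (hmap : MapsTo g (Icc a b) (Icc a b)) (hmap' : MapsTo ginv (Icc a b) (Icc a b))
    (hinv : InvOn ginv g (Icc a b) (Icc a b))
    (huv : Icc u v ⊆ Icc a b) (i : ℤ) :
    MeasurableSet (zIter g ginv i '' Icc u v) := by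
  have hci : ∀ n : ℕ, ContinuousOn g^[n] (Icc a b) := fun n => hc.iterate hmap n
  cases i with
  | ofNat n => exact (isCompact_Icc.image_of_continuousOn ((hci n).mono huv)).measurableSet
  | negSucc n =>
    have hl : LeftInvOn ginv^[n + 1] g^[n + 1] (Icc a b) := leftInvOn_iterate hinv.1 hmap (n + 1)
    have hr : LeftInvOn g^[n + 1] ginv^[n + 1] (Icc a b) := leftInvOn_iterate hinv.2 hmap' (n + 1)
    have e : zIter g ginv (Int.negSucc n) '' Icc u v = Icc a b ∩ g^[n + 1] ⁻¹' Icc u v := by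
      ext x
      constructor
      · rintro ⟨w, hw, rfl⟩
        refine ⟨hmap'.iterate (n + 1) (huv hw), ?_⟩
        change g^[n + 1] (ginv^[n + 1] w) ∈ Icc u v
        rwa [hr (huv hw)]
      · rintro ⟨hx, hxw⟩
        exact ⟨_, hxw, hl hx⟩
    rw [e]
    exact ((hci (n + 1)).preimage_isClosed_of_isClosed isClosed_Icc isClosed_Icc).measurableSet

end Iterates

theorem iterate_mem_Icc_mul_pow {g : ℝ → ℝ} {δ q : ℝ} (hq0 : 0 ≤ q) (hq1 : q ≤ 1)
    (h : ∀ x ∈ Icc 0 δ, g x ∈ Icc 0 (q * x)) (n : ℕ) {x : ℝ} (hx : x ∈ Icc 0 δ) :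
    g^[n] x ∈ Icc 0 (q ^ n * x) := by
  induction n with
  | zero => simpa using hx.1
  | succ n ih =>
    have hle : q ^ n * x ≤ x := mul_le_of_le_one_left hx.1 (pow_le_one₀ hq0 hq1)
    have h1 := h _ ⟨ih.1, ih.2.trans (hle.trans hx.2)⟩
    rw [Function.iterate_succ_apply']
    refine ⟨h1.1, h1.2.trans ?_⟩
    rw [pow_succ', mul_assoc]
    exact mul_le_mul_of_nonneg_left ih.2 hq0

theorem hasDerivWithinAt_iterate {g g' : ℝ → ℝ} {s : Set ℝ} (hmap : MapsTo g s s)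
    (hd : ∀ x ∈ s, HasDerivWithinAt g (g' x) s x) (n : ℕ) {x : ℝ} (hx : x ∈ s) :
    HasDerivWithinAt g^[n] (∏ k ∈ Finset.range n, g' (g^[k] x)) s x := by
  induction n with
  | zero => simpa using hasDerivWithinAt_id x s
  | succ n ih =>
    rw [Finset.prod_range_succ, mul_comm, Function.iterate_succ']
    exact (hd _ (hmap.iterate n hx)).comp x ih (hmap.iterate n)

/-- Bounded distortion of the iterates of a contraction whose derivative is Hölder continuous. -/
theorem prod_deriv_iterate_le {g g' : ℝ → ℝ} {δ q m C θ : ℝ} (hδ : δ ≤ 1) (hq0 : 0 < q)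
    (hq1 : q < 1) (hm : 0 < m) (hθ : 0 < θ) (hC : 0 ≤ C)
    (h : ∀ x ∈ Icc 0 δ, g x ∈ Icc 0 (q * x)) (hmg : ∀ x ∈ Icc 0 δ, m ≤ g' x)
    (hH : ∀ x ∈ Icc 0 δ, ∀ y ∈ Icc 0 δ, |g' x - g' y| ≤ C * |x - y| ^ θ)
    (n : ℕ) {a b : ℝ} (ha : a ∈ Icc 0 δ) (hb : b ∈ Icc 0 δ) :
    ∏ k ∈ Finset.range n, g' (g^[k] a) ≤
      Real.exp (C / m * (1 - q ^ θ)⁻¹) * ∏ k ∈ Finset.range n, g' (g^[k] b) := by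
  have hmem : ∀ (k : ℕ) {x : ℝ}, x ∈ Icc 0 δ → g^[k] x ∈ Icc 0 δ := fun k x hx => by
    have h1 := iterate_mem_Icc_mul_pow hq0.le hq1.le h k hx
    exact ⟨h1.1, h1.2.trans ((mul_le_of_le_one_left hx.1 (pow_le_one₀ hq0.le hq1.le)).trans hx.2)⟩
  have hsmall : ∀ (k : ℕ) {x : ℝ}, x ∈ Icc 0 δ → g^[k] x ∈ Icc 0 (q ^ k) := fun k x hx => by
    have h1 := iterate_mem_Icc_mul_pow hq0.le hq1.le h k hx
    exact ⟨h1.1, h1.2.trans (mul_le_of_le_one_right (by positivity) (hx.2.trans hδ))⟩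
  have hr0 : 0 < q ^ θ := Real.rpow_pos_of_pos hq0 θ
  have hr1 : q ^ θ < 1 := Real.rpow_lt_one hq0.le hq1 hθ
  have step : ∀ k : ℕ, g' (g^[k] a) ≤ Real.exp (C / m * (q ^ θ) ^ k) * g' (g^[k] b) := by
    intro k
    have hA := hsmall k ha
    have hB := hsmall k hb
    have hab : |g^[k] a - g^[k] b| ≤ q ^ k := by
      rw [abs_le]
      constructor <;> linarith [hA.1, hA.2, hB.1, hB.2]
    have hpow : |g^[k] a - g^[k] b| ^ θ ≤ (q ^ θ) ^ k := by
      calc |g^[k] a - g^[k] b| ^ θ ≤ (q ^ k) ^ θ :=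
            Real.rpow_le_rpow (abs_nonneg _) hab hθ.le
        _ = (q ^ θ) ^ k := (Real.rpow_pow_comm hq0.le θ k).symm
    have h1 := (le_abs_self _).trans (hH _ (hmem k ha) _ (hmem k hb))
    have hmb := hmg _ (hmem k hb)
    have h2 : C * |g^[k] a - g^[k] b| ^ θ ≤ C / m * (q ^ θ) ^ k * g' (g^[k] b) := by
      calc C * |g^[k] a - g^[k] b| ^ θ ≤ C * (q ^ θ) ^ k := by gcongr
        _ = C / m * (q ^ θ) ^ k * m := by field_simp
        _ ≤ _ := by gcongr
    have h3 := Real.add_one_le_exp (C / m * (q ^ θ) ^ k)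
    nlinarith [mul_le_mul_of_nonneg_right h3 (hm.le.trans hmb)]
  calc ∏ k ∈ Finset.range n, g' (g^[k] a)
      ≤ ∏ k ∈ Finset.range n, Real.exp (C / m * (q ^ θ) ^ k) * g' (g^[k] b) :=
        Finset.prod_le_prod (fun k _ => hm.le.trans (hmg _ (hmem k ha))) fun k _ => step k
    _ = Real.exp (C / m * ∑ k ∈ Finset.range n, (q ^ θ) ^ k) *
          ∏ k ∈ Finset.range n, g' (g^[k] b) := by
        rw [Finset.prod_mul_distrib, ← Real.exp_sum, Finset.mul_sum]
    _ ≤ _ := by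
        have hsum : ∑ k ∈ Finset.range n, (q ^ θ) ^ k ≤ (1 - q ^ θ)⁻¹ := by
          rw [← tsum_geometric_of_lt_one hr0.le hr1]
          exact (summable_geometric_of_lt_one hr0.le hr1).sum_le_tsum _ fun _ _ => by positivity
        have : 0 ≤ ∏ k ∈ Finset.range n, g' (g^[k] b) :=
          Finset.prod_nonneg fun k _ => hm.le.trans (hmg _ (hmem k hb))
        gcongr

/-- Near a hyperbolic sink, the derivative is bounded away from zero and the map contracts. -/
theorem IsC1PlusNS.exists_contraction {g g' : ℝ → ℝ} (hg : IsC1PlusNS g g')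
    (hβ : g' 0 ∈ Ioo (0:ℝ) 1) :
    ∃ δ ∈ Ioo (0:ℝ) 1, ∃ q ∈ Ioo (0:ℝ) 1, ∃ m > 0,
      (∀ x ∈ Icc 0 δ, m ≤ g' x) ∧ ∀ x ∈ Icc 0 δ, g x ∈ Icc 0 (q * x) := by
  obtain ⟨hb0, hb1⟩ := hβ
  have hc := hg.1.2.2.1 0 (by simp)
  obtain ⟨ε, hε, hball⟩ := Metric.mem_nhdsWithin_iff.1
    (hc (Ioo_mem_nhds (by linarith : g' 0 / 2 < g' 0) (by linarith : g' 0 < (1 + g' 0) / 2)))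
  have hδ0 : 0 < min (ε / 2) (1 / 2) := by positivity
  have hδ1 : min (ε / 2) (1 / 2) < 1 := (min_le_right _ _).trans_lt (by norm_num)
  have hδε : min (ε / 2) (1 / 2) < ε := (min_le_left _ _).trans_lt (by linarith)
  generalize min (ε / 2) (1 / 2) = δ at *
  have hsub : Icc 0 δ ⊆ Icc (0:ℝ) 1 := Icc_subset_Icc_right hδ1.le
  have hbd : ∀ x ∈ Icc 0 δ, g' 0 / 2 < g' x ∧ g' x < (1 + g' 0) / 2 := fun x hx =>
    hball ⟨by rw [Metric.mem_ball, Real.dist_eq, sub_zero, abs_of_nonneg hx.1]; linarith [hx.2],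
      hsub hx⟩
  refine ⟨δ, ⟨hδ0, hδ1⟩, (1 + g' 0) / 2, ⟨by linarith, by linarith⟩, g' 0 / 2, by linarith,
    fun x hx => (hbd x hx).1.le, fun x hx => ⟨(hg.1.1.mapsTo (hsub hx)).1, ?_⟩⟩
  have h := (convex_Icc 0 δ).norm_image_sub_le_of_norm_hasDerivWithin_le (f := g) (f' := g')
    (C := (1 + g' 0) / 2) (fun z hz => (hg.1.2.1 z (hsub hz)).mono hsub)
    (fun z hz => by
      rw [Real.norm_eq_abs, abs_of_pos (hg.1.2.2.2.1 z (hsub hz))]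
      exact (hbd z hz).2.le) (left_mem_Icc.2 hδ0.le) hx
  rw [hg.2.1, sub_zero, sub_zero, Real.norm_eq_abs, Real.norm_eq_abs, abs_of_nonneg hx.1] at h
  exact (le_abs_self _).trans h

/-- Iterates of an increasing surjection of `[0,1]` carry half-open intervals to half-open
intervals, and preserve sets which are invariant under all integer iterates. -/
theorem iterate_image_orbit_inter_Ioc {g ginv : ℝ → ℝ} {s A : Set ℝ} (hbij : BijOn g s s)
    (hmono : StrictMonoOn g s) (hconn : s.OrdConnected) (hginv : InvOn ginv g s s) (hA : A ⊆ s)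
    (n : ℕ) {a b : ℝ} (ha : a ∈ s) (hb : b ∈ s) :
    g^[n] '' Ioc a b = Ioc (g^[n] a) (g^[n] b) ∧
      g^[n] '' ((⋃ m : ℤ, zIter g ginv m '' A) ∩ Ioc a b) =
        (⋃ m : ℤ, zIter g ginv m '' A) ∩ Ioc (g^[n] a) (g^[n] b) := by
  have hmap' : MapsTo ginv s s := hginv.1.mapsTo hbij.surjOn
  have hmap : MapsTo g s s := hbij.mapsTo
  have hm : StrictMonoOn g^[n] s := strictMonoOn_iterate hmono hmap n
  have hsurj : SurjOn g^[n] s s := hbij.surjOn.iterate n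
  have hmapn : MapsTo g^[n] s s := hmap.iterate n
  have hI : Ioc a b ⊆ s := Ioc_subset_Icc_self.trans (hconn.out ha hb)
  have hback : ∀ z ∈ Ioc (g^[n] a) (g^[n] b), ∃ x ∈ Ioc a b, g^[n] x = z := by
    intro z hz
    obtain ⟨x, hx, rfl⟩ := hsurj
      ((hconn.out (hmapn ha) (hmapn hb)) (Ioc_subset_Icc_self hz))
    exact ⟨x, ⟨(hm.lt_iff_lt ha hx).1 hz.1, (hm.le_iff_le hx hb).1 hz.2⟩, rfl⟩
  have hfwd : MapsTo g^[n] (Ioc a b) (Ioc (g^[n] a) (g^[n] b)) := fun x hx =>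
    ⟨hm ha (hI hx) hx.1, hm.monotoneOn (hI hx) hb hx.2⟩
  refine ⟨hfwd.image_subset.antisymm fun z hz => ?_, Subset.antisymm ?_ ?_⟩
  · exact hback z hz
  · rintro _ ⟨x, ⟨hxU, hx⟩, rfl⟩
    refine ⟨?_, hfwd hx⟩
    obtain ⟨m, w, hw, rfl⟩ := mem_iUnion.1 hxU
    exact mem_iUnion.2 ⟨m + n, w, hw, (iterate_zIter hmap' hginv.2 m n (hA hw)).symm⟩
  · rintro z ⟨hzU, hz⟩
    obtain ⟨x, hx, rfl⟩ := hback z hz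
    refine ⟨x, ⟨?_, hx⟩, rfl⟩
    obtain ⟨m, w, hw, hmw⟩ := mem_iUnion.1 hzU
    refine mem_iUnion.2 ⟨m - n, w, hw, hm.injOn (mapsTo_zIter hmap hmap' _ (hA hw)) (hI hx) ?_⟩
    rw [iterate_zIter hmap' hginv.2 _ _ (hA hw), sub_add_cancel, hmw]

/-- Claim: uniform proportion.  `Ω_i := (g^{i+1}(y), g^{i}(y)]`,
`J* := ⋃_{i ∈ ℤ} g^{i}(J)`, `J_i := J* ∩ Ω_i`. -/
theorem uniform_proportion (g g' ginv : ℝ → ℝ)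
    (hg : IsC1PlusNS g g') (hβ : g' 0 ∈ Set.Ioo (0:ℝ) 1)
    (hginv : Set.InvOn ginv g (Set.Icc 0 1) (Set.Icc 0 1)) :
    ∃ δ₀ ∈ Set.Ioo (0:ℝ) 1, ∃ ρ ∈ Set.Ioo (0:ℝ) 1,
      ∀ y ∈ Set.Ioo (0:ℝ) 1, ∀ u v : ℝ, u ≤ v → Set.Icc u v ⊆ Set.Ioo (0:ℝ) 1 →
        ∀ i j : ℤ,
          Set.Ioc (zIter g ginv (i + 1) y) (zIter g ginv i y) ⊆ Set.Icc 0 δ₀ →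
          Set.Ioc (zIter g ginv (j + 1) y) (zIter g ginv j y) ⊆ Set.Icc 0 δ₀ →
          ρ * ((volume ((⋃ m : ℤ, zIter g ginv m '' Set.Icc u v) ∩
                  Set.Ioc (zIter g ginv (i + 1) y) (zIter g ginv i y))).toReal /
                (volume (Set.Ioc (zIter g ginv (i + 1) y) (zIter g ginv i y))).toReal) ≤
              (volume ((⋃ m : ℤ, zIter g ginv m '' Set.Icc u v) ∩
                  Set.Ioc (zIter g ginv (j + 1) y) (zIter g ginv j y))).toReal /
                (volume (Set.Ioc (zIter g ginv (j + 1) y) (zIter g ginv j y))).toReal ∧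
          (volume ((⋃ m : ℤ, zIter g ginv m '' Set.Icc u v) ∩
              Set.Ioc (zIter g ginv (j + 1) y) (zIter g ginv j y))).toReal /
            (volume (Set.Ioc (zIter g ginv (j + 1) y) (zIter g ginv j y))).toReal ≤
            ρ⁻¹ * ((volume ((⋃ m : ℤ, zIter g ginv m '' Set.Icc u v) ∩
                  Set.Ioc (zIter g ginv (i + 1) y) (zIter g ginv i y))).toReal /
                (volume (Set.Ioc (zIter g ginv (i + 1) y) (zIter g ginv i y))).toReal) := by
  obtain ⟨δ, hδ, q, hq, m, hm, hmg, hgq⟩ := hg.exists_contraction hβ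
  obtain ⟨hbij, hder, hcont, hpos, C₀, θ, hθ, -, hH₀⟩ := hg.1
  have hH : ∀ x ∈ Icc (0:ℝ) 1, ∀ y ∈ Icc (0:ℝ) 1, |g' x - g' y| ≤ |C₀| * |x - y| ^ θ :=
    fun x hx y hy => (hH₀ x hx y hy).trans (by gcongr; exact le_abs_self _)
  have hsub : Icc 0 δ ⊆ Icc (0:ℝ) 1 := Icc_subset_Icc_right hδ.2.le
  have hmap := hbij.mapsTo
  have hmap' := mapsTo_inverse_Icc hbij hginv
  have hmapδ : MapsTo g (Icc 0 δ) (Icc 0 δ) := fun x hx =>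
    ⟨(hgq x hx).1, (hgq x hx).2.trans ((mul_le_of_le_one_left hx.1 hq.2.le).trans hx.2)⟩
  set K := Real.exp (|C₀| / m * (1 - q ^ θ)⁻¹)
  have hK0 : 0 < K := Real.exp_pos _
  refine ⟨δ, hδ, (K ^ 2 + 1)⁻¹, ⟨by positivity, inv_lt_one_of_one_lt₀ (by nlinarith)⟩, ?_⟩
  intro y hy u v _ hJ
  have hJ' : Icc u v ⊆ Icc (0:ℝ) 1 := hJ.trans Ioo_subset_Icc_self
  have hy' := Ioo_subset_Icc_self hy
  have hmeas : MeasurableSet (⋃ k : ℤ, zIter g ginv k '' Icc u v) :=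
    MeasurableSet.iUnion fun k => measurableSet_zIter_image
      (fun x hx => (hder x hx).continuousWithinAt) hmap hmap' hginv hJ' k
  set P : ℤ → ℝ := fun i =>
    (volume ((⋃ k : ℤ, zIter g ginv k '' Icc u v) ∩
      Ioc (zIter g ginv (i + 1) y) (zIter g ginv i y))).toReal /
    (volume (Ioc (zIter g ginv (i + 1) y) (zIter g ginv i y))).toReal with hP
  have main : ∀ (i : ℤ) (n : ℕ), Ioc (zIter g ginv (i + 1) y) (zIter g ginv i y) ⊆ Icc 0 δ →
      P (i + n) ≤ K ^ 2 * P i ∧ P i ≤ K ^ 2 * P (i + n) := by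
    intro i n hi
    have ha := mapsTo_zIter hg.mapsTo_Ioo (hg.mapsTo_inverse_Ioo hginv) i hy
    have hga : zIter g ginv (i + 1) y = g (zIter g ginv i y) :=
      (apply_zIter hmap' hginv.2 i hy').symm
    have hlt : zIter g ginv (i + 1) y < zIter g ginv i y := hga ▸ hg.2.2.2 _ ha
    have ha1 := mapsTo_zIter hmap hmap' (i + 1) hy'
    obtain ⟨e1, e2⟩ := iterate_image_orbit_inter_Ioc hbij hg.strictMonoOn ordConnected_Icc
      hginv hJ' n ha1 (Ioo_subset_Icc_self ha)
    rw [iterate_zIter hmap' hginv.2 _ _ hy', iterate_zIter hmap' hginv.2 _ _ hy',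
      add_right_comm i 1 (n : ℤ)] at e1 e2
    have h := relative_volume_image_bounds (f := g^[n])
      (D := fun x => ∏ k ∈ Finset.range n, g' (g^[k] x)) hK0 measurableSet_Ioc
      (hmeas.inter measurableSet_Ioc) inter_subset_right measure_Ioc_lt_top.ne
      (nonempty_Ioc.2 hlt) (by rw [Real.volume_Ioc, ENNReal.toReal_ofReal] <;> linarith)
      (fun x hx => (hasDerivWithinAt_iterate hmapδ
        (fun z hz => (hder z (hsub hz)).mono hsub) n (hi hx)).mono hi)
      (((strictMonoOn_iterate hg.strictMonoOn hmap n).injOn.mono hsub).mono hi)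
      (fun x hx => Finset.prod_pos fun k _ => hpos _ (hmap.iterate k (hsub (hi hx))))
      (fun a ha b hb => prod_deriv_iterate_le hδ.2.le hq.1 hq.2 hm hθ (abs_nonneg C₀) hgq hmg
        (fun x hx z hz => hH x (hsub hx) z (hsub hz)) n (hi ha) (hi hb))
    rwa [e1, e2] at h
  have hP0 : ∀ i, 0 ≤ P i := fun i => div_nonneg ENNReal.toReal_nonneg ENNReal.toReal_nonneg
  intro i j hi hj
  change (K ^ 2 + 1)⁻¹ * P i ≤ P j ∧ P j ≤ (K ^ 2 + 1)⁻¹⁻¹ * P i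
  have both : P j ≤ K ^ 2 * P i ∧ P i ≤ K ^ 2 * P j := by
    rcases le_total i j with hij | hij
    · obtain ⟨n, rfl⟩ := Int.le.dest hij
      exact main i n hi
    · obtain ⟨n, rfl⟩ := Int.le.dest hij
      exact (main j n hj).symm
  rw [inv_inv, inv_mul_le_iff₀ (by positivity)]
  constructor <;> nlinarith [hP0 i, hP0 j, both.1, both.2]
end

section
/- Let g : [0,1] → [0,1] be a C¹ diffeomorphism with Hölder-continuous derivative such that g(0) = 0, g(1) = 1, g(t) < t for all t ∈ (0,1), and β := g'(0) ∈ (0,1). Then for every nondegenerate closed interval J ⊆ (0,1) there exists a constant c > 0 such that |g^{i}(J)| ≥ c·β^{i} for all i ∈ ℕ. -/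
open Set MeasureTheory

open Filter Topology

/-- A positive sequence that is eventually bounded away from `0` is bounded away from `0`. -/
lemma exists_pos_forall_le_of_forall_ge {a : ℕ → ℝ} (ha : ∀ i, 0 < a i) {c : ℝ} (hc : 0 < c)
    (N : ℕ) (h : ∀ i, N ≤ i → c ≤ a i) : ∃ d > 0, ∀ i, d ≤ a i := by
  induction N generalizing c with
  | zero => exact ⟨c, hc, fun i => h i (Nat.zero_le i)⟩
  | succ n ih =>
    refine ih (lt_min hc (ha n)) fun i hi => ?_
    rcases hi.eq_or_lt with rfl | hi
    · exact min_le_right _ _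
    · exact (min_le_left _ _).trans (h i hi)

/-- If `y` decays geometrically and `a (i + 1) / a i` is at least `1 - K * y i`, then `a` stays
above half its initial value as soon as `y 0` is small enough. -/
lemma half_le_of_one_sub_mul_le {a y : ℕ → ℝ} {K M ρ : ℝ} (ha : ∀ i, 0 < a i)
    (hy : ∀ i, 0 ≤ y i) (hM : 0 ≤ M) (hK : 0 ≤ K) (hKM : K ≤ M * (1 - ρ))
    (hdecay : ∀ i, y (i + 1) ≤ ρ * y i) (hratio : ∀ i, (1 - K * y i) * a i ≤ a (i + 1))
    (hK0 : ∀ i, K * y i ≤ 1) (h0 : M * y 0 ≤ 1 / 2) (i : ℕ) : a 0 / 2 ≤ a i := by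
  have key : ∀ i, M * y i ≤ M * y 0 ∧ a 0 * (1 - M * y 0 + M * y i) ≤ a i := by
    intro i
    induction i with
    | zero => simp
    | succ n ih =>
      obtain ⟨ih₁, ih₂⟩ := ih
      have h₁ : K * y n ≤ M * (1 - ρ) * y n := mul_le_mul_of_nonneg_right hKM (hy n)
      have h₂ : M * y (n + 1) ≤ M * (ρ * y n) := mul_le_mul_of_nonneg_left (hdecay n) hM
      have h₃ : 0 ≤ K * y n := mul_nonneg hK (hy n)
      refine ⟨by nlinarith, le_trans ?_ (hratio n)⟩
      have h₄ := mul_le_mul_of_nonneg_left ih₂ (sub_nonneg.2 (hK0 n))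
      refine le_trans ?_ h₄
      rw [mul_left_comm]
      refine mul_le_mul_of_nonneg_left ?_ (ha 0).le
      have h₅ : 0 ≤ K * y n * (M * y 0 - M * y n) := mul_nonneg h₃ (sub_nonneg.2 ih₁)
      nlinarith
  have h₁ := (key i).2
  have h₂ := mul_nonneg hM (hy i)
  have h₃ := mul_le_mul_of_nonneg_left (show 1 / 2 ≤ 1 - M * y 0 + M * y i by linarith) (ha 0).le
  linarith

namespace IsC1PlusDiffeo

variable {g g' : ℝ → ℝ}

lemma continuousOn (hg : IsC1PlusDiffeo g g') : ContinuousOn g (Icc 0 1) :=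
  fun x hx => (hg.2.1 x hx).continuousWithinAt

lemma mapsTo (hg : IsC1PlusDiffeo g g') : MapsTo g (Icc 0 1) (Icc 0 1) := hg.1.mapsTo

/-- The mean value theorem for a diffeomorphism of `[0,1]`. -/
lemma exists_sub_eq_mul (hg : IsC1PlusDiffeo g g') {x y : ℝ} (hx : 0 ≤ x) (hxy : x < y)
    (hy : y ≤ 1) : ∃ ξ ∈ Ioo x y, g y - g x = g' ξ * (y - x) := by
  obtain ⟨ξ, hξ, h⟩ := exists_hasDerivAt_eq_slope g g' hxy
    (hg.continuousOn.mono (Icc_subset_Icc hx hy)) fun z hz =>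
      (hg.2.1 z ⟨hx.trans hz.1.le, hz.2.le.trans hy⟩).hasDerivAt
        (Icc_mem_nhds (hx.trans_lt hz.1) (hz.2.trans_le hy))
  exact ⟨ξ, hξ, by rw [h, div_mul_cancel₀ _ (sub_pos.2 hxy).ne']⟩

lemma strictMonoOn (hg : IsC1PlusDiffeo g g') : StrictMonoOn g (Icc 0 1) := by
  intro x hx y hy hxy
  obtain ⟨ξ, hξ, h⟩ := hg.exists_sub_eq_mul hx.1 hxy hy.2
  have := hg.2.2.2.1 ξ ⟨hx.1.trans hξ.1.le, hξ.2.le.trans hy.2⟩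
  have := mul_pos this (sub_pos.2 hxy)
  linarith

lemma strictMonoOn_iterate (hg : IsC1PlusDiffeo g g') (i : ℕ) :
    StrictMonoOn g^[i] (Icc 0 1) := by
  induction i with
  | zero => exact strictMonoOn_id
  | succ n ih => exact ih.comp hg.strictMonoOn hg.mapsTo

/-- The iterates of an interval have at least the length given by the images of the endpoints. -/
lemma sub_le_volume_image_iterate (hg : IsC1PlusDiffeo g g') {u v : ℝ} (huv : u ≤ v)
    (hJ : Icc u v ⊆ Icc 0 1) (i : ℕ) :
    g^[i] v - g^[i] u ≤ (volume (g^[i] '' Icc u v)).toReal := by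
  have hcont : ContinuousOn g^[i] (Icc u v) := (hg.continuousOn.iterate hg.mapsTo i).mono hJ
  have hfin : volume (g^[i] '' Icc u v) ≠ ⊤ :=
    measure_ne_top_of_subset
      ((image_mono hJ).trans (hg.mapsTo.iterate i).image_subset) (by simp)
  have h := ENNReal.toReal_mono hfin (measure_mono (intermediate_value_Icc huv hcont))
  rw [Real.volume_Icc] at h
  exact (le_max_left _ _).trans (by rwa [ENNReal.toReal_ofReal'] at h)

end IsC1PlusDiffeo

namespace IsC1PlusNS

variable {g g' : ℝ → ℝ}

lemma mapsTo_Ioo_s7 (hg : IsC1PlusNS g g') : MapsTo g (Ioo 0 1) (Ioo 0 1) := by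
  intro x hx
  refine ⟨?_, (hg.2.2.2 x hx).trans hx.2⟩
  have := hg.1.strictMonoOn (left_mem_Icc.2 zero_le_one) (Ioo_subset_Icc_self hx) hx.1
  rwa [hg.2.1] at this

/-- Every orbit in `(0,1)` converges to the attracting fixed point `0`. -/
lemma tendsto_iterate (hg : IsC1PlusNS g g') {v : ℝ} (hv : v ∈ Ioo (0 : ℝ) 1) :
    Tendsto (fun i => g^[i] v) atTop (𝓝 0) := by
  have hmem : ∀ i, g^[i] v ∈ Ioo (0 : ℝ) 1 := fun i => hg.mapsTo_Ioo_s7.iterate i hv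
  have hanti : Antitone fun i => g^[i] v := antitone_nat_of_succ_le fun i => by
    rw [Function.iterate_succ_apply']
    exact (hg.2.2.2 _ (hmem i)).le
  have hlim := tendsto_atTop_ciInf hanti ⟨0, by rintro _ ⟨i, rfl⟩; exact (hmem i).1.le⟩
  set l := ⨅ i, g^[i] v
  have hl0 : 0 ≤ l := ge_of_tendsto' hlim fun i => (hmem i).1.le
  have hlv : l ≤ v := hanti.le_of_tendsto hlim 0
  have hl1 : l < 1 := hlv.trans_lt hv.2
  have hstep : Tendsto (fun i => g^[i + 1] v) atTop (𝓝 (g l)) := by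
    simp only [Function.iterate_succ_apply']
    exact (hg.1.continuousOn l ⟨hl0, hl1.le⟩).tendsto.comp
      (tendsto_nhdsWithin_iff.2 ⟨hlim, .of_forall fun i => Ioo_subset_Icc_self (hmem i)⟩)
  have hfix : g l = l := tendsto_nhds_unique hstep (hlim.comp (tendsto_add_atTop_nat 1))
  rcases hl0.eq_or_lt with h | h
  · rwa [← h] at hlim
  · exact absurd hfix (hg.2.2.2 l ⟨h, hl1⟩).ne

/-- Near a hyperbolic sink at `0`, the map contracts by a definite factor. -/
lemma eventually_iterate_succ_le (hg : IsC1PlusNS g g') {v l : ℝ} (hv : v ∈ Ioo (0 : ℝ) 1)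
    (hl : g' 0 < l) : ∀ᶠ i in atTop, g^[i + 1] v ≤ l * g^[i] v := by
  have hmem : ∀ i, g^[i] v ∈ Ioo (0 : ℝ) 1 := fun i => hg.mapsTo_Ioo_s7.iterate i hv
  have hd := (hg.1.2.2.1 0 (left_mem_Icc.2 zero_le_one)).eventually_lt_const hl
  obtain ⟨ε, hε, hball⟩ := Metric.mem_nhdsWithin_iff.1 hd
  filter_upwards [(hg.tendsto_iterate hv).eventually_lt_const hε] with i hi
  obtain ⟨ξ, hξ, h⟩ := hg.1.exists_sub_eq_mul le_rfl (hmem i).1 (hmem i).2.le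
  have hξl : g' ξ < l := hball ⟨by
    rw [Metric.mem_ball, Real.dist_eq, sub_zero, abs_of_pos hξ.1]
    exact hξ.2.trans hi, hξ.1.le, hξ.2.le.trans (hmem i).2.le⟩
  rw [Function.iterate_succ_apply']
  rw [hg.2.1, sub_zero, sub_zero] at h
  rw [h]
  exact mul_le_mul_of_nonneg_right hξl.le (hmem i).1.le

end IsC1PlusNS

/-- for every nondegenerate closed interval `J = [u,v] ⊆ (0,1)` there is
`c > 0` with `|g^{i}(J)| ≥ c·β^{i}` for all `i ∈ ℕ`, where `β = g'(0)`. -/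
theorem iterate_interval_length_lower_bound (g g' : ℝ → ℝ)
    (hg : IsC1PlusNS g g') (hβ : g' 0 ∈ Set.Ioo (0:ℝ) 1)
    (u v : ℝ) (huv : u < v) (hJ : Set.Icc u v ⊆ Set.Ioo (0:ℝ) 1) :
    ∃ c > (0:ℝ), ∀ i : ℕ,
      c * (g' 0) ^ i ≤ (volume (g^[i] '' Set.Icc u v)).toReal := by
  obtain ⟨hβ0, hβ1⟩ := hβ
  obtain ⟨C, θ, hθ, -, hC⟩ := hg.1.2.2.2.2
  have hu := hJ (left_mem_Icc.2 huv.le)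
  have hv := hJ (right_mem_Icc.2 huv.le)
  have humem : ∀ i, g^[i] u ∈ Ioo (0 : ℝ) 1 := fun i => hg.mapsTo_Ioo_s7.iterate i hu
  have hvmem : ∀ i, g^[i] v ∈ Ioo (0 : ℝ) 1 := fun i => hg.mapsTo_Ioo_s7.iterate i hv
  have hlt : ∀ i, g^[i] u < g^[i] v := fun i =>
    hg.1.strictMonoOn_iterate i (Ioo_subset_Icc_self hu) (Ioo_subset_Icc_self hv) huv
  let a : ℕ → ℝ := fun i => (g^[i] v - g^[i] u) / g' 0 ^ i
  let y : ℕ → ℝ := fun i => (g^[i] v) ^ θ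
  have ha : ∀ i, 0 < a i := fun i => div_pos (sub_pos.2 (hlt i)) (pow_pos hβ0 i)
  have hy : ∀ i, 0 ≤ y i := fun i => Real.rpow_nonneg (hvmem i).1.le θ
  obtain ⟨l, hl, hl1⟩ := exists_between hβ1
  have hl0 : 0 < l := hβ0.trans hl
  have hρ : 0 < 1 - l ^ θ := sub_pos.2 (Real.rpow_lt_one hl0.le hl1 hθ)
  set K := |C| / g' 0 with hKdef
  have hK : 0 ≤ K := by positivity
  set M := K / (1 - l ^ θ)
  have hM : 0 ≤ M := by positivity
  have hratio : ∀ i, (1 - K * y i) * a i ≤ a (i + 1) := by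
    intro i
    obtain ⟨ξ, hξ, h⟩ := hg.1.exists_sub_eq_mul (humem i).1.le (hlt i) (hvmem i).2.le
    have hξ0 : 0 < ξ := (humem i).1.trans hξ.1
    have hξβ : g' 0 - |C| * y i ≤ g' ξ := by
      have h₁ := hC 0 (left_mem_Icc.2 zero_le_one) ξ ⟨hξ0.le, (hξ.2.trans (hvmem i).2).le⟩
      rw [zero_sub, abs_neg, abs_of_pos hξ0] at h₁
      have h₂ : C * ξ ^ θ ≤ |C| * y i :=
        mul_le_mul (le_abs_self C) (Real.rpow_le_rpow hξ0.le hξ.2.le hθ.le)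
          (Real.rpow_nonneg hξ0.le θ) (abs_nonneg C)
      have h₃ := le_abs_self (g' 0 - g' ξ)
      linarith
    simp only [a, Function.iterate_succ_apply', h]
    rw [pow_succ', mul_div_mul_comm]
    refine mul_le_mul_of_nonneg_right ?_ (ha i).le
    rw [le_div_iff₀ hβ0, hKdef]
    calc (1 - |C| / g' 0 * y i) * g' 0 = g' 0 - |C| * y i := by field_simp
      _ ≤ g' ξ := hξβ
  have hylim : Tendsto y atTop (𝓝 0) := by
    have := (hg.tendsto_iterate hv).rpow_const (p := θ) (.inr hθ.le)
    rwa [Real.zero_rpow hθ.ne'] at this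
  have hsmall : ∀ B : ℝ, ∀ ε > 0, ∀ᶠ i in atTop, B * y i ≤ ε := fun B ε hε => by
    have := hylim.const_mul B
    rw [mul_zero] at this
    exact this.eventually_le_const hε
  obtain ⟨N, hN⟩ := eventually_atTop.1 ((hsmall K 1 one_pos).and
    ((hsmall M (1 / 2) one_half_pos).and (hg.eventually_iterate_succ_le hv hl)))
  have hhalf : ∀ k, a N / 2 ≤ a (N + k) :=
    half_le_of_one_sub_mul_le (a := fun k => a (N + k)) (y := fun k => y (N + k)) (ρ := l ^ θ)
      (fun k => ha _) (fun k => hy _) hM hK (div_mul_cancel₀ K hρ.ne').ge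
      (fun k => by
        have h := Real.rpow_le_rpow (hvmem _).1.le (hN (N + k) (Nat.le_add_right _ _)).2.2 hθ.le
        rwa [Real.mul_rpow hl0.le (hvmem _).1.le] at h)
      (fun k => hratio _) (fun k => (hN _ (Nat.le_add_right _ _)).1) (hN N le_rfl).2.1
  obtain ⟨c, hc, hca⟩ := exists_pos_forall_le_of_forall_ge ha (half_pos (ha N)) N fun i hi => by
    obtain ⟨k, rfl⟩ := Nat.exists_eq_add_of_le hi
    exact hhalf k
  exact ⟨c, hc, fun i => ((le_div_iff₀ (pow_pos hβ0 i)).1 (hca i)).trans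
    (hg.1.sub_le_volume_image_iterate huv.le (hJ.trans Ioo_subset_Icc_self) i)⟩
end

section
/- Let g : [0,1] → [0,1] be a C¹ diffeomorphism with g(0) = 0, g(1) = 1, g' > 0 and g(t) < t for all t ∈ (0,1). Fix w ∈ (0,1) and set D₀ := (g(w), w]. Then there exist ε₀ > 0 and an increasing function G : (0,ε₀) → (0,1) with lim_{ε→0+} G(ε) = 0 such that for every ε ∈ (0,ε₀) and all s, t ∈ D₀ there exists r ∈ {−1, 0, 1} with |g^{r}([s − G(ε), s]) ∩ (g(t), t]| ≥ ε. -/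
open Set MeasureTheory

/-- A function whose derivative within `[0, 1]` is positive and continuous is bi-Lipschitz
there. -/
lemma exists_bilipschitz_of_hasDerivWithinAt {g g' : ℝ → ℝ}
    (hgderiv : ∀ x ∈ Set.Icc (0:ℝ) 1, HasDerivWithinAt g (g' x) (Set.Icc 0 1) x)
    (hgc : ContinuousOn g' (Set.Icc 0 1)) (hgpos : ∀ x ∈ Set.Icc (0:ℝ) 1, 0 < g' x) :
    ∃ m > (0:ℝ), ∃ M > (0:ℝ), ∀ x ∈ Set.Icc (0:ℝ) 1, ∀ y ∈ Set.Icc (0:ℝ) 1, x ≤ y →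
      m * (y - x) ≤ g y - g x ∧ g y - g x ≤ M * (y - x) := by
  have hne : (Set.Icc (0:ℝ) 1).Nonempty := Set.nonempty_Icc.2 zero_le_one
  obtain ⟨a, ha, hmin⟩ := isCompact_Icc.exists_isMinOn hne hgc
  obtain ⟨b, hb, hmax⟩ := isCompact_Icc.exists_isMaxOn hne hgc
  have hcont : ContinuousOn g (Set.Icc 0 1) := fun x hx => (hgderiv x hx).continuousWithinAt
  have hder : ∀ x ∈ interior (Set.Icc (0:ℝ) 1), HasDerivAt g (g' x) x := fun x hx =>
    (hgderiv x (interior_subset hx)).hasDerivAt (mem_interior_iff_mem_nhds.1 hx)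
  have hdiff : DifferentiableOn ℝ g (interior (Set.Icc 0 1)) := fun x hx =>
    (hder x hx).differentiableAt.differentiableWithinAt
  refine ⟨g' a, hgpos a ha, g' b, hgpos b hb, fun x hx y hy hxy => ⟨?_, ?_⟩⟩
  · refine (convex_Icc 0 1).mul_sub_le_image_sub_of_le_deriv hcont hdiff (fun z hz => ?_)
      x hx y hy hxy
    rw [(hder z hz).deriv]
    exact hmin (interior_subset hz)
  · refine (convex_Icc 0 1).image_sub_le_mul_sub_of_deriv_le hcont hdiff (fun z hz => ?_)
      x hx y hy hxy
    rw [(hder z hz).deriv]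
    exact hmax (interior_subset hz)

/-- If `A ∩ (a, b]` contains an interval `(u - ε, u]`, then its measure is at least `ε`. -/
lemma le_volume_inter_Ioc {A : Set ℝ} {a b u ε : ℝ} (hε : 0 ≤ ε)
    (h : Set.Ioc (u - ε) u ⊆ A) (ha : a ≤ u - ε) (hb : u ≤ b) :
    ε ≤ (volume (A ∩ Set.Ioc a b)).toReal := by
  have hfin : volume (A ∩ Set.Ioc a b) ≠ ⊤ :=
    measure_ne_top_of_subset Set.inter_subset_right measure_Ioc_lt_top.ne
  have hle := ENNReal.toReal_mono hfin
    (measure_mono (Set.subset_inter h (Set.Ioc_subset_Ioc ha hb)))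
  rwa [Real.volume_Ioc, sub_sub_cancel, ENNReal.toReal_ofReal hε] at hle

/-- Claim: fundamental intersection.  `g` is an orientation-preserving `C¹`
diffeomorphism of `[0,1]` with only fixed points `0, 1` and decreasing interior orbits,
`ginv` is its inverse on `[0,1]`, `w ∈ (0,1)` and `D₀ = (g w, w]`. -/
theorem fundamental_intersection (g g' ginv : ℝ → ℝ)
    (hgbij : Set.BijOn g (Set.Icc 0 1) (Set.Icc 0 1))
    (hgderiv : ∀ x ∈ Set.Icc (0:ℝ) 1, HasDerivWithinAt g (g' x) (Set.Icc 0 1) x)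
    (hgc : ContinuousOn g' (Set.Icc 0 1))
    (hgpos : ∀ x ∈ Set.Icc (0:ℝ) 1, 0 < g' x)
    (hg0 : g 0 = 0) (hg1 : g 1 = 1)
    (hglt : ∀ t ∈ Set.Ioo (0:ℝ) 1, g t < t)
    (hginv : Set.InvOn ginv g (Set.Icc 0 1) (Set.Icc 0 1))
    (w : ℝ) (hw : w ∈ Set.Ioo (0:ℝ) 1) :
    ∃ ε₀ > (0:ℝ), ∃ G : ℝ → ℝ,
      MonotoneOn G (Set.Ioo 0 ε₀) ∧
      (∀ ε ∈ Set.Ioo (0:ℝ) ε₀, G ε ∈ Set.Ioo (0:ℝ) 1) ∧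
      Filter.Tendsto G (nhdsWithin 0 (Set.Ioi 0)) (nhds 0) ∧
      ∀ ε ∈ Set.Ioo (0:ℝ) ε₀, ∀ s ∈ Set.Ioc (g w) w, ∀ t ∈ Set.Ioc (g w) w,
        ∃ r : ℤ, |r| ≤ 1 ∧
          ε ≤ (volume (zIter g ginv r '' Set.Icc (s - G ε) s ∩ Set.Ioc (g t) t)).toReal := by
  obtain ⟨m, hm, M, hM, hmM⟩ := exists_bilipschitz_of_hasDerivWithinAt hgderiv hgc hgpos
  have hmono : StrictMonoOn g (Set.Icc 0 1) := fun x hx y hy hxy => by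
    nlinarith [(hmM x hx y hy hxy.le).1, mul_pos hm (sub_pos.2 hxy)]
  have hcont : ContinuousOn g (Set.Icc 0 1) := fun x hx => (hgderiv x hx).continuousWithinAt
  have hgw0 : 0 < g w := hg0 ▸ hmono (by simp) ⟨hw.1.le, hw.2.le⟩ hw.1
  have hsub : Set.Icc (g w) w ⊆ Set.Icc 0 1 := Set.Icc_subset_Icc hgw0.le hw.2.le
  obtain ⟨a, ha, hmin⟩ := isCompact_Icc.exists_isMinOn (Set.nonempty_Icc.2 (hglt w hw).le)
    (continuousOn_id.sub (hcont.mono hsub))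
  have hc : 0 < a - g a := sub_pos.2 (hglt a ⟨hgw0.trans_le ha.1, ha.2.trans_lt hw.2⟩)
  set C : ℝ := 1 + M + m⁻¹ with hC
  have hminv : 0 < m⁻¹ := inv_pos.2 hm
  have hC0 : 0 < C := by positivity
  refine ⟨min (a - g a) C⁻¹, lt_min hc (inv_pos.2 hC0), fun ε => C * ε,
    fun x _ y _ hxy => mul_le_mul_of_nonneg_left hxy hC0.le, ?_, ?_, ?_⟩
  · intro ε hε
    refine ⟨mul_pos hC0 hε.1, ?_⟩
    calc C * ε < C * C⁻¹ := mul_lt_mul_of_pos_left (hε.2.trans_le (min_le_right _ _)) hC0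
      _ = 1 := mul_inv_cancel₀ hC0.ne'
  · have : Filter.Tendsto (fun ε : ℝ => C * ε) (nhds 0) (nhds (C * 0)) :=
      (continuous_const_mul C).tendsto 0
    rw [mul_zero] at this
    exact this.mono_left nhdsWithin_le_nhds
  intro ε hε s hs t ht
  have hε0 : 0 < ε := hε.1
  have hs01 : s ∈ Set.Icc (0:ℝ) 1 := hsub ⟨hs.1.le, hs.2⟩
  have ht01 : t ∈ Set.Icc (0:ℝ) 1 := hsub ⟨ht.1.le, ht.2⟩
  have hgapt : a - g a ≤ t - g t := hmin ⟨ht.1.le, ht.2⟩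
  have hgap : ε < t - g t := (hε.2.trans_le (min_le_left _ _)).trans_le hgapt
  have hδ : C * ε = ε + M * ε + m⁻¹ * ε := by rw [hC]; ring
  have hMε : 0 < M * ε := mul_pos hM hε0
  have hmε : 0 < m⁻¹ * ε := mul_pos hminv hε0
  have hmmε : m * (m⁻¹ * ε) = ε := mul_inv_cancel_left₀ hm.ne' ε
  have hw01 : w ∈ Set.Icc (0:ℝ) 1 := ⟨hw.1.le, hw.2.le⟩
  have hgt0 : 0 ≤ g t := (hgbij.mapsTo ht01).1
  have hgtw : g t ≤ g w := hmono.monotoneOn ht01 hw01 ht.2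
  have hgsw : g s ≤ g w := hmono.monotoneOn hs01 hw01 hs.2
  rcases le_or_gt s t with hst | hst
  · rcases le_or_gt ε (s - g t) with h | h
    · refine ⟨0, by norm_num, le_volume_inter_Ioc hε0.le (u := s) ?_ (by linarith) hst⟩
      intro y hy
      exact ⟨y, ⟨by linarith [hy.1], hy.2⟩, rfl⟩
    · refine ⟨-1, by norm_num, le_volume_inter_Ioc hε0.le (u := t) ?_ (by linarith) le_rfl⟩
      intro y hy
      have hy01 : y ∈ Set.Icc (0:ℝ) 1 := ⟨by linarith [hy.1], hy.2.trans ht01.2⟩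
      have hup := (hmM y hy01 t ht01 hy.2).2
      have hMy : M * (t - y) ≤ M * ε :=
        mul_le_mul_of_nonneg_left (by linarith [hy.1]) hM.le
      have hgy : g y ≤ g t := hmono.monotoneOn hy01 ht01 hy.2
      exact ⟨g y, ⟨by linarith, by linarith [hs.1]⟩, hginv.1 hy01⟩
  · rcases le_or_gt (s - t) (C * ε - ε) with h | h
    · refine ⟨0, by norm_num, le_volume_inter_Ioc hε0.le (u := t) ?_ (by linarith) le_rfl⟩
      intro y hy
      exact ⟨y, ⟨by linarith [hy.1], hy.2.trans hst.le⟩, rfl⟩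
    · have hlow := (hmM t ht01 s hs01 hst.le).1
      have hfar : m * (m⁻¹ * ε) ≤ m * (s - t) :=
        mul_le_mul_of_nonneg_left (by linarith) hm.le
      refine ⟨1, by norm_num, le_volume_inter_Ioc hε0.le (u := g s) ?_ (by linarith)
        (by linarith [ht.1])⟩
      intro y hy
      obtain ⟨x, hx, rfl⟩ := hgbij.surjOn
        (⟨by linarith [hy.1], hy.2.trans (hgbij.mapsTo hs01).2⟩ : y ∈ Set.Icc (0:ℝ) 1)
      have hxs : x ≤ s := (hmono.le_iff_le hx hs01).1 hy.2
      have hnear : s - x ≤ m⁻¹ * ε := by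
        refine le_of_mul_le_mul_left ?_ hm
        linarith [(hmM x hx s hs01 hxs).1, hy.1]
      exact ⟨x, ⟨by linarith, hxs⟩, rfl⟩
end

section
/- Let Σ := {0,1}^ℤ with the product topology and let σ : Σ → Σ be the left shift, σ(x)_i = x_{i+1}. Let Φ : [0,1] → [0,1] be a homeomorphism with Φ(0) = 0, Φ(1) = 1 and Φ(t) < t for all t ∈ (0,1). Define F : Σ × [0,1] → Σ × [0,1] by F(x, t) = (σ(x), Φ(t)) if x₀ = 0 and F(x, t) = (σ(x), Φ^{−1}(t)) if x₀ = 1. Then F is a homeomorphism of Σ × [0,1] which is not topologically transitive: there exist nonempty disjoint open F-invariant subsets of Σ × [0,1]; equivalently, there exist nonempty open sets U, V ⊆ Σ × [0,1] with F^{n}(U) ∩ V = ∅ for all n ∈ ℤ. -/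
open Set

/-- Points whose two-sided orbit under the homeomorphism `Φ` meets `I`. -/
def orbitSaturation {X : Type*} [TopologicalSpace X] (Φ : X ≃ₜ X) (I : Set X) : Set X :=
  {t | ∃ n : ℤ, (Φ ^ n) t ∈ I}

section orbitSaturation

variable {X : Type*} [TopologicalSpace X] (Φ : X ≃ₜ X)

lemma subset_orbitSaturation (I : Set X) : I ⊆ orbitSaturation Φ I :=
  fun _ ht => ⟨0, ht⟩

lemma IsOpen.orbitSaturation {I : Set X} (hI : IsOpen I) : IsOpen (orbitSaturation Φ I) := by
  have h : _root_.orbitSaturation Φ I = ⋃ n : ℤ, (Φ ^ n : X ≃ₜ X) ⁻¹' I := by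
    ext t
    simp [_root_.orbitSaturation]
  rw [h]
  exact isOpen_iUnion fun n => hI.preimage (Φ ^ n).continuous

lemma apply_mem_orbitSaturation_iff {I : Set X} {t : X} :
    Φ t ∈ orbitSaturation Φ I ↔ t ∈ orbitSaturation Φ I := by
  have shift : ∀ n : ℤ, (Φ ^ n) (Φ t) = (Φ ^ (n + 1)) t := fun n => by
    rw [zpow_add_one]
    rfl
  constructor
  · rintro ⟨n, hn⟩
    exact ⟨n + 1, shift n ▸ hn⟩
  · rintro ⟨n, hn⟩
    refine ⟨n - 1, ?_⟩
    rwa [shift, sub_add_cancel]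

lemma symm_apply_mem_orbitSaturation_iff {I : Set X} {t : X} :
    Φ.symm t ∈ orbitSaturation Φ I ↔ t ∈ orbitSaturation Φ I := by
  rw [← apply_mem_orbitSaturation_iff, Φ.apply_symm_apply]

variable [LinearOrder X]

lemma Homeomorph.pow_le_of_map_le (hΦ : Monotone Φ) {c s : X} (hc : Φ c ≤ c) (hs : s ≤ c)
    (k : ℕ) : (Φ ^ k) s ≤ c := by
  induction k with
  | zero => exact hs
  | succ k ih =>
    rw [pow_succ']
    exact (hΦ ih).trans hc

lemma Homeomorph.eq_zero_of_zpow_mem_Ioo (hΦ : Monotone Φ) {c s : X} {n : ℤ}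
    (hs : s ∈ Ioo (Φ c) c) (hn : (Φ ^ n) s ∈ Ioo (Φ c) c) : n = 0 := by
  have hc : Φ c ≤ c := (hs.1.trans hs.2).le
  have key : ∀ (k : ℕ) (u : X), u ≤ c → (Φ ^ (k + 1)) u ≤ Φ c := fun k u hu => by
    rw [pow_succ']
    exact hΦ (Homeomorph.pow_le_of_map_le Φ hΦ hc hu k)
  rcases lt_trichotomy n 0 with h | h | h
  · obtain ⟨k, rfl⟩ : ∃ k : ℕ, n = -((k + 1 : ℕ) : ℤ) := ⟨(-n - 1).toNat, by omega⟩
    have h1 := key k _ hn.2.le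
    rw [zpow_neg, zpow_natCast] at h1
    have h2 : (Φ ^ (k + 1)) ((Φ ^ (k + 1))⁻¹ s) = s := (Φ ^ (k + 1)).apply_symm_apply s
    rw [h2] at h1
    exact absurd hs.1 h1.not_gt
  · exact h
  · obtain ⟨k, rfl⟩ : ∃ k : ℕ, n = ((k + 1 : ℕ) : ℤ) := ⟨(n - 1).toNat, by omega⟩
    rw [zpow_natCast] at hn
    exact absurd hn.1 (key k s hs.2.le).not_gt

lemma disjoint_orbitSaturation (hΦ : Monotone Φ) {c : X} {I J : Set X} (hI : I ⊆ Ioo (Φ c) c)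
    (hJ : J ⊆ Ioo (Φ c) c) (hIJ : Disjoint I J) :
    Disjoint (orbitSaturation Φ I) (orbitSaturation Φ J) := by
  rw [Set.disjoint_left]
  rintro t ⟨n, hn⟩ ⟨m, hm⟩
  have e : (Φ ^ (m - n)) ((Φ ^ n) t) = (Φ ^ m) t := by
    rw [← Homeomorph.mul_apply, ← zpow_add, sub_add_cancel]
  have h0 := Homeomorph.eq_zero_of_zpow_mem_Ioo Φ hΦ (hI hn) (e ▸ hJ hm)
  obtain rfl : m = n := by omega
  exact Set.disjoint_left.1 hIJ hn hm

end orbitSaturation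

lemma Continuous.ite_eq_false {X Y : Type*} [TopologicalSpace X] [TopologicalSpace Y]
    {b : X → Bool} {f g : X → Y} (hb : Continuous b) (hf : Continuous f) (hg : Continuous g) :
    Continuous fun p => if b p = false then f p else g p :=
  hf.if (fun p hp => by
    have hclopen : IsClopen {p | b p = false} := (isClopen_discrete {false}).preimage hb
    simp [hclopen.frontier_eq] at hp) hg

lemma isHomeomorph_shift_skew_product {Y : Type*} [TopologicalSpace Y] (Φ : Y ≃ₜ Y) :
    IsHomeomorph fun p : (ℤ → Bool) × Y =>
      ((fun i => p.1 (i + 1) : ℤ → Bool), if p.1 0 = false then Φ p.2 else Φ.symm p.2) := by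
  rw [isHomeomorph_iff_exists_inverse]
  refine ⟨?_, fun p => (fun i => p.1 (i - 1), if p.1 (-1) = false then Φ.symm p.2 else Φ p.2),
    ?_, ?_, ?_⟩
  · exact Continuous.prodMk (by fun_prop)
      (Continuous.ite_eq_false (by fun_prop) (by fun_prop) (by fun_prop))
  · rintro ⟨x, t⟩
    by_cases h : x 0 = false <;> simp [h]
  · rintro ⟨x, t⟩
    by_cases h : x (-1) = false <;> simp [h]
  · exact Continuous.prodMk (by fun_prop)
      (Continuous.ite_eq_false (by fun_prop) (by fun_prop) (by fun_prop))

lemma image_iterate_inter_eq_empty {X : Type*} {F : X → X} {U V : Set X} (hU : F '' U = U)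
    (hUV : Disjoint U V) (n : ℕ) : F^[n] '' U ∩ V = ∅ := by
  have h : F^[n] '' U = U := by
    rw [Set.image_iterate_eq]
    exact Function.iterate_fixed hU n
  rw [h]
  exact hUV.inter_eq

/-- Remark: base structure.  `Σ = {0,1}^ℤ` (here `ℤ → Bool`) with the
product topology, `σ` the left shift, `Φ` a homeomorphism of `[0,1]` fixing the endpoints
with `Φ t < t` on the interior, and `F(x,t) = (σ x, Φ t)` if `x₀ = 0` (`false`), and
`F(x,t) = (σ x, Φ⁻¹ t)` if `x₀ = 1` (`true`).  Then `F` is a homeomorphism which is not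
topologically transitive: there are nonempty disjoint open `F`-invariant sets `U, V`;
in particular `F^n(U) ∩ V = ∅` for all iterates (both forward and backward). -/
theorem shift_skew_product_not_transitive
    (Φ : (Set.Icc (0:ℝ) 1) ≃ₜ (Set.Icc (0:ℝ) 1))
    (hΦ0 : ∀ t : Set.Icc (0:ℝ) 1, (t : ℝ) = 0 → ((Φ t : ℝ) = 0))
    (hΦ1 : ∀ t : Set.Icc (0:ℝ) 1, (t : ℝ) = 1 → ((Φ t : ℝ) = 1))
    (hΦlt : ∀ t : Set.Icc (0:ℝ) 1, (t : ℝ) ∈ Set.Ioo (0:ℝ) 1 → (Φ t : ℝ) < (t : ℝ))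
    (F : (ℤ → Bool) × (Set.Icc (0:ℝ) 1) → (ℤ → Bool) × (Set.Icc (0:ℝ) 1))
    (hF : ∀ (x : ℤ → Bool) (t : Set.Icc (0:ℝ) 1),
      F (x, t) = ((fun i => x (i + 1)), if x 0 = false then Φ t else Φ.symm t)) :
    IsHomeomorph F ∧
      ∃ U V : Set ((ℤ → Bool) × (Set.Icc (0:ℝ) 1)),
        U.Nonempty ∧ V.Nonempty ∧ IsOpen U ∧ IsOpen V ∧ Disjoint U V ∧
        F '' U = U ∧ F '' V = V ∧
        (∀ n : ℕ, (F^[n] '' U) ∩ V = ∅ ∧ (F^[n] '' V) ∩ U = ∅) := by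
  have hFeq : F = fun p : (ℤ → Bool) × (Set.Icc (0:ℝ) 1) =>
      ((fun i => p.1 (i + 1) : ℤ → Bool), if p.1 0 = false then Φ p.2 else Φ.symm p.2) :=
    funext fun p => hF p.1 p.2
  have hhomeo : IsHomeomorph F := hFeq ▸ isHomeomorph_shift_skew_product Φ
  have hmono : Monotone Φ := by
    refine (Φ.continuous.strictMono_of_inj_boundedOrder ?_ Φ.injective).monotone
    rw [← Subtype.coe_le_coe, hΦ0 ⊥ rfl, hΦ1 ⊤ rfl]
    exact zero_le_one
  have hinv : ∀ I : Set (Set.Icc (0:ℝ) 1),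
      F '' (univ ×ˢ orbitSaturation Φ I) = univ ×ˢ orbitSaturation Φ I := fun I => by
    have hpre : F ⁻¹' (univ ×ˢ orbitSaturation Φ I) = univ ×ˢ orbitSaturation Φ I := by
      ext ⟨x, t⟩
      by_cases h : x 0 = false <;>
        simp [hF, h, apply_mem_orbitSaturation_iff, symm_apply_mem_orbitSaturation_iff]
    conv_lhs => rw [← hpre]
    exact image_preimage_eq _ hhomeo.surjective
  obtain ⟨c, hc⟩ : ∃ c, Φ c < c :=
    ⟨⟨1 / 2, by norm_num, by norm_num⟩, hΦlt _ ⟨by norm_num, by norm_num⟩⟩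
  obtain ⟨d, hd1, hd2⟩ := exists_between hc
  have hdisj : Disjoint ((univ : Set (ℤ → Bool)) ×ˢ orbitSaturation Φ (Ioo (Φ c) d))
      (univ ×ˢ orbitSaturation Φ (Ioo d c)) :=
    Disjoint.set_prod_right (disjoint_orbitSaturation Φ hmono (Ioo_subset_Ioo_right hd2.le)
      (Ioo_subset_Ioo_left hd1.le)
      (Set.disjoint_left.2 fun _ h1 h2 => lt_asymm h1.2 h2.1)) _ _
  refine ⟨hhomeo, univ ×ˢ orbitSaturation Φ (Ioo (Φ c) d), univ ×ˢ orbitSaturation Φ (Ioo d c),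
    univ_nonempty.prod ((nonempty_Ioo.2 hd1).mono (subset_orbitSaturation Φ _)),
    univ_nonempty.prod ((nonempty_Ioo.2 hd2).mono (subset_orbitSaturation Φ _)),
    isOpen_univ.prod (isOpen_Ioo.orbitSaturation Φ),
    isOpen_univ.prod (isOpen_Ioo.orbitSaturation Φ), hdisj, hinv _, hinv _, fun n =>
    ⟨image_iterate_inter_eq_empty (hinv _) hdisj n,
      image_iterate_inter_eq_empty (hinv _) hdisj.symm n⟩⟩
end
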